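/- arXiv:1008.3520 — 2 statements merged into one kernel-verified Lean document; each statement's English description precedes it below -/
import Mathlib

section
/- Let a > 0, b ∈ ℝ, and let X₁ = {u ∈ C_c^{2,α}(ℝ₀⁺) : u(0) = 0, a·u''(0) + b·u'(0) = 0, supp(u) ⊂ [0, C] for some C > 0}, where u'(0), u''(0) are the one-sided derivatives at 0. Then there exist δ > 0 and a continuous linear extension operator E : X₁ → C_c^{2,α}(ℝ) such that Eu = u on [0, ∞), supp(Eu) ⊂ [−δ, ∞), and ‖Eu‖_{C⁰(ℝ)} = ‖u‖_{C⁰(ℝ₀⁺)} for every u ∈ X₁. -/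
open scoped NNReal
open Set

noncomputable section

/-- Membership in
`X₁ = {u ∈ C_c^{2,α}(ℝ₀⁺) ∣ a u''(0) + b u'(0) = u(0) = 0, supp u ⊆ [0, C]}`,
where the derivatives at `0` are one-sided (derivatives within `[0, ∞)`). -/
def MemX1 (α : ℝ≥0) (a b : ℝ) (u : ℝ → ℝ) : Prop :=
  ContDiffOn ℝ 2 u (Ici 0) ∧
  (∃ C : ℝ≥0, HolderOnWith C α
    (derivWithin (derivWithin u (Ici 0)) (Ici 0)) (Ici 0)) ∧
  u 0 = 0 ∧
  a * derivWithin (derivWithin u (Ici 0)) (Ici 0) 0 + b * derivWithin u (Ici 0) 0 = 0 ∧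
  (∃ C : ℝ, 0 < C ∧ ∀ x : ℝ, C < x → u x = 0)

open Filter Topology
open scoped ContDiff

/-! ### Glueing functions at the origin -/

/-- The function equal to `f` on `[0, ∞)` and to `g` on `(-∞, 0)`. -/
def glue (f g : ℝ → ℝ) (x : ℝ) : ℝ := if 0 ≤ x then f x else g x

lemma glue_of_nonneg (f g : ℝ → ℝ) {x : ℝ} (hx : 0 ≤ x) : glue f g x = f x := if_pos hx

lemma glue_of_nonpos {f g : ℝ → ℝ} (h : f 0 = g 0) {x : ℝ} (hx : x ≤ 0) : glue f g x = g x := by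
  rcases hx.lt_or_eq with hx | rfl
  · exact if_neg hx.not_ge
  · rw [glue_of_nonneg f g le_rfl, h]

lemma hasDerivAt_glue {f g f' g' : ℝ → ℝ}
    (hf : ∀ x ∈ Ici (0 : ℝ), HasDerivWithinAt f (f' x) (Ici 0) x)
    (hg : ∀ x ∈ Iic (0 : ℝ), HasDerivWithinAt g (g' x) (Iic 0) x)
    (h : f 0 = g 0) (h' : f' 0 = g' 0) (x : ℝ) :
    HasDerivAt (glue f g) (glue f' g' x) x := by
  have right : ∀ x, 0 ≤ x → HasDerivWithinAt (glue f g) (glue f' g' x) (Ici 0) x := fun x hx => by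
    rw [glue_of_nonneg f' g' hx]
    exact (hf x hx).congr (fun y hy => glue_of_nonneg f g hy) (glue_of_nonneg f g hx)
  have left : ∀ x, x ≤ 0 → HasDerivWithinAt (glue f g) (glue f' g' x) (Iic 0) x := fun x hx => by
    rw [glue_of_nonpos h' hx]
    exact (hg x hx).congr (fun y hy => glue_of_nonpos h hy) (glue_of_nonpos h hx)
  rcases lt_trichotomy x 0 with hx | rfl | hx
  · exact (left x hx.le).hasDerivAt (Iic_mem_nhds hx)
  · simpa [Iic_union_Ici] using (left 0 le_rfl).union (right 0 le_rfl)
  · exact (right x hx.le).hasDerivAt (Ici_mem_nhds hx)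

lemma continuous_glue {f g : ℝ → ℝ} (hf : ContinuousOn f (Ici 0)) (hg : ContinuousOn g (Iic 0))
    (h : f 0 = g 0) : Continuous (glue f g) := by
  rw [← continuousOn_univ, ← Iic_union_Ici (a := (0 : ℝ))]
  exact (hg.congr fun x hx => glue_of_nonpos h hx).union_of_isClosed
    (hf.congr fun x hx => glue_of_nonneg f g hx) isClosed_Iic isClosed_Ici

/-! ### Hölder estimates -/

lemma holderOnWith_of_abs_sub_le {C α : ℝ≥0} {f : ℝ → ℝ} {s : Set ℝ}
    (h : ∀ x ∈ s, ∀ y ∈ s, |f x - f y| ≤ C * |x - y| ^ (α : ℝ)) : HolderOnWith C α f s := by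
  intro x hx y hy
  rw [edist_dist, edist_dist, ENNReal.ofReal_rpow_of_nonneg dist_nonneg α.coe_nonneg,
    ← ENNReal.ofReal_coe_nnreal, ← ENNReal.ofReal_mul C.coe_nonneg]
  exact ENNReal.ofReal_le_ofReal (h x hx y hy)

/-- Hölder estimates on the two sides of a point `p` add up. -/
lemma abs_sub_le_of_Iic_of_Ici {C D α p : ℝ} (hα : 0 ≤ α) (hC : 0 ≤ C) (hD : 0 ≤ D)
    {f : ℝ → ℝ} {s : Set ℝ} (hp : p ∈ s)
    (hl : ∀ x ∈ s ∩ Iic p, ∀ y ∈ s ∩ Iic p, |f x - f y| ≤ C * |x - y| ^ α)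
    (hr : ∀ x ∈ s ∩ Ici p, ∀ y ∈ s ∩ Ici p, |f x - f y| ≤ D * |x - y| ^ α) :
    ∀ x ∈ s, ∀ y ∈ s, |f x - f y| ≤ (C + D) * |x - y| ^ α := by
  have key : ∀ x ∈ s, ∀ y ∈ s, x ≤ y → |f x - f y| ≤ (C + D) * |x - y| ^ α := by
    intro x hx y hy hxy
    have hpos : 0 ≤ |x - y| ^ α := Real.rpow_nonneg (abs_nonneg _) _
    rcases le_total y p with hyp | hyp
    · nlinarith [hl x ⟨hx, hxy.trans hyp⟩ y ⟨hy, hyp⟩, mul_nonneg hD hpos]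
    rcases le_total p x with hxp | hxp
    · nlinarith [hr x ⟨hx, hxp⟩ y ⟨hy, hyp⟩, mul_nonneg hC hpos]
    have hxp' : |x - p| ^ α ≤ |x - y| ^ α := Real.rpow_le_rpow (abs_nonneg _)
      (by rw [abs_of_nonpos (by linarith), abs_of_nonpos (by linarith)]; linarith) hα
    have hpy' : |p - y| ^ α ≤ |x - y| ^ α := Real.rpow_le_rpow (abs_nonneg _)
      (by rw [abs_of_nonpos (by linarith), abs_of_nonpos (by linarith)]; linarith) hα
    calc |f x - f y| ≤ |f x - f p| + |f p - f y| := abs_sub_le _ _ _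
      _ ≤ C * |x - p| ^ α + D * |p - y| ^ α :=
        add_le_add (hl x ⟨hx, hxp⟩ p ⟨hp, self_mem_Iic⟩) (hr p ⟨hp, self_mem_Ici⟩ y ⟨hy, hyp⟩)
      _ ≤ C * |x - y| ^ α + D * |x - y| ^ α := by gcongr
      _ = (C + D) * |x - y| ^ α := by ring
  intro x hx y hy
  rcases le_total x y with h | h
  · exact key x hx y hy h
  · rw [abs_sub_comm, abs_sub_comm x]
    exact key y hy x hx h

/-- `B` bounds `|f|` and the Lipschitz constant of `f` on `[-1, 0]`. -/
def LipBound (B : ℝ) (f : ℝ → ℝ) : Prop :=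
  ∀ x ∈ Icc (-1 : ℝ) 0, |f x| ≤ B ∧ ∀ y ∈ Icc (-1 : ℝ) 0, |f x - f y| ≤ B * |x - y|

lemma ContDiff.eventually_lipBound {f : ℝ → ℝ} (hf : ContDiff ℝ 1 f) :
    ∀ᶠ B in atTop, LipBound B f := by
  obtain ⟨C, hC⟩ := isCompact_Icc.exists_bound_of_continuousOn
    (hf.continuous.continuousOn (s := Icc (-1 : ℝ) 0))
  obtain ⟨D, hD⟩ := isCompact_Icc.exists_bound_of_continuousOn
    ((contDiff_one_iff_deriv.1 hf).2.continuousOn (s := Icc (-1 : ℝ) 0))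
  filter_upwards [eventually_ge_atTop C, eventually_ge_atTop D] with B hCB hDB x hx
  refine ⟨(hC x hx).trans hCB, fun y hy => ?_⟩
  exact (convex_Icc (-1 : ℝ) 0).norm_image_sub_le_of_norm_deriv_le
    (fun z _ => (contDiff_one_iff_deriv.1 hf).1 z) (fun z hz => (hD z hz).trans hDB) hy hx

lemma abs_le_rpow_of_mem_Icc {α : ℝ} (hα1 : α ≤ 1) {x y : ℝ}
    (hx : x ∈ Icc (-1 : ℝ) 0) (hy : y ∈ Icc (-1 : ℝ) 0) : |x - y| ≤ |x - y| ^ α := by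
  rcases (abs_nonneg (x - y)).eq_or_lt with h | h
  · rw [← h]
    exact Real.rpow_nonneg le_rfl _
  · refine Real.self_le_rpow_of_le_one h.le ?_ hα1
    rw [abs_le]
    constructor <;> linarith [hx.1, hx.2, hy.1, hy.2]

lemma LipBound.abs_mul_sub_mul_le {α : ℝ} (hα1 : α ≤ 1) {B M N : ℝ} {A w : ℝ → ℝ}
    (hA : LipBound B A) (hw : ∀ x ∈ Icc (-1 : ℝ) 0, |w x| ≤ M)
    (hw' : ∀ x ∈ Icc (-1 : ℝ) 0, ∀ y ∈ Icc (-1 : ℝ) 0, |w x - w y| ≤ N * |x - y| ^ α)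
    {x y : ℝ} (hx : x ∈ Icc (-1 : ℝ) 0) (hy : y ∈ Icc (-1 : ℝ) 0) :
    |A x * w x - A y * w y| ≤ B * (N + M) * |x - y| ^ α := by
  have hB : 0 ≤ B := (abs_nonneg _).trans (hA x hx).1
  calc |A x * w x - A y * w y| = |A x * (w x - w y) + (A x - A y) * w y| := by congr 1; ring
    _ ≤ |A x| * |w x - w y| + |A x - A y| * |w y| := by
      simpa only [abs_mul] using abs_add_le (A x * (w x - w y)) ((A x - A y) * w y)
    _ ≤ B * (N * |x - y| ^ α) + B * |x - y| ^ α * M := by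
      have := abs_le_rpow_of_mem_Icc hα1 hx hy
      have h1 := (hA x hx).1
      have h2 := hw' x hx y hy
      have h3 := ((hA x hx).2 y hy).trans (mul_le_mul_of_nonneg_left this hB)
      have h4 := hw y hy
      gcongr
    _ = B * (N + M) * |x - y| ^ α := by ring

/-! ### The cutoff and the reflection -/

/-- A smooth cutoff, equal to `0` near `(-∞, -1]` and to `1` near `[0, ∞)`. -/
def cutoff (x : ℝ) : ℝ := Real.smoothTransition (2 + 3 * x)

lemma contDiff_cutoff : ContDiff ℝ ∞ cutoff :=
  Real.smoothTransition.contDiff.comp (contDiff_const.add (contDiff_const.mul contDiff_id))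

lemma abs_cutoff_le_one (x : ℝ) : |cutoff x| ≤ 1 :=
  abs_le.2 ⟨by linarith [show 0 ≤ cutoff x from Real.smoothTransition.nonneg _],
    Real.smoothTransition.le_one _⟩

lemma cutoff_eventuallyEq_zero {x : ℝ} (hx : x ≤ -1) : cutoff =ᶠ[𝓝 x] fun _ => 0 := by
  filter_upwards [Iio_mem_nhds (show x < -2 / 3 by linarith)] with y hy
  exact Real.smoothTransition.zero_of_nonpos (by linarith [mem_Iio.1 hy])

lemma cutoff_eventuallyEq_one : cutoff =ᶠ[𝓝 0] fun _ => 1 := by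
  filter_upwards [Ioi_mem_nhds (show (-1 / 3 : ℝ) < 0 by norm_num)] with y hy
  exact Real.smoothTransition.one_of_one_le (by linarith [mem_Ioi.1 hy])

lemma cutoff_of_le {x : ℝ} (hx : x ≤ -1) : cutoff x = 0 := (cutoff_eventuallyEq_zero hx).eq_of_nhds

lemma deriv_cutoff_of_le {x : ℝ} (hx : x ≤ -1) : deriv cutoff x = 0 := by
  simpa using (cutoff_eventuallyEq_zero hx).deriv_eq

lemma deriv_deriv_cutoff_of_le {x : ℝ} (hx : x ≤ -1) : deriv (deriv cutoff) x = 0 := by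
  simpa using (cutoff_eventuallyEq_zero hx).deriv.deriv_eq

lemma cutoff_zero : cutoff 0 = 1 := cutoff_eventuallyEq_one.eq_of_nhds

lemma deriv_cutoff_zero : deriv cutoff 0 = 0 := by
  simpa using cutoff_eventuallyEq_one.deriv_eq

/-- A reflection of `(-∞, 0]` to `[0, ∞)` with first derivative `-1` and second derivative `2 c`
at the origin. -/
def reflection (c x : ℝ) : ℝ := -x * Real.exp (-(c * x))

/-- The first derivative of `reflection c`. -/
def reflection' (c x : ℝ) : ℝ := (c * x - 1) * Real.exp (-(c * x))

/-- The second derivative of `reflection c`. -/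
def reflection'' (c x : ℝ) : ℝ := (2 * c - c ^ 2 * x) * Real.exp (-(c * x))

lemma contDiff_reflection (c : ℝ) : ContDiff ℝ ∞ (reflection c) := by
  unfold reflection; fun_prop

lemma contDiff_reflection' (c : ℝ) : ContDiff ℝ ∞ (reflection' c) := by
  unfold reflection'; fun_prop

lemma contDiff_reflection'' (c : ℝ) : ContDiff ℝ ∞ (reflection'' c) := by
  unfold reflection''; fun_prop

lemma hasDerivAt_exp_neg_mul (c x : ℝ) :
    HasDerivAt (fun x => Real.exp (-(c * x))) (Real.exp (-(c * x)) * -c) x := by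
  simpa using (((hasDerivAt_id x).const_mul c).neg).exp

lemma hasDerivAt_reflection (c x : ℝ) : HasDerivAt (reflection c) (reflection' c x) x := by
  refine (show HasDerivAt (reflection c) _ x from
    (hasDerivAt_id x).neg.mul (hasDerivAt_exp_neg_mul c x)).congr_deriv ?_
  simp only [reflection', Pi.neg_apply, id]
  ring

lemma hasDerivAt_reflection' (c x : ℝ) : HasDerivAt (reflection' c) (reflection'' c x) x := by
  refine (show HasDerivAt (reflection' c) _ x from
    (((hasDerivAt_id x).const_mul c).sub_const 1).mul (hasDerivAt_exp_neg_mul c x)).congr_deriv ?_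
  simp only [reflection'', id]
  ring

lemma reflection_mapsTo (c : ℝ) : MapsTo (reflection c) (Iic 0) (Ici 0) := fun _ hx =>
  mul_nonneg (neg_nonneg.2 hx) (Real.exp_pos _).le

/-! ### Derivatives of the reflected function -/

/-- The reflected, cut off function `-χ · (u ∘ φ)`. -/
def reflected (c : ℝ) (u : ℝ → ℝ) (x : ℝ) : ℝ := -cutoff x * u (reflection c x)

/-- The derivative of `reflected c u`, where `u₁` is the derivative of `u`. -/
def reflected' (c : ℝ) (u u₁ : ℝ → ℝ) (x : ℝ) : ℝ :=
  -deriv cutoff x * u (reflection c x) + -(cutoff x * reflection' c x) * u₁ (reflection c x)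

/-- The coefficient of the first derivative in `reflected''`. -/
def crossCoeff (c x : ℝ) : ℝ :=
  -(2 * (deriv cutoff x * reflection' c x) + cutoff x * reflection'' c x)

/-- The second derivative of `reflected c u`, where `u₁`, `u₂` are the derivatives of `u`. -/
def reflected'' (c : ℝ) (u u₁ u₂ : ℝ → ℝ) (x : ℝ) : ℝ :=
  -deriv (deriv cutoff) x * u (reflection c x) + crossCoeff c x * u₁ (reflection c x) +
    -(cutoff x * reflection' c x ^ 2) * u₂ (reflection c x)

lemma contDiff_deriv_cutoff : ContDiff ℝ ∞ (deriv cutoff) :=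
  (contDiff_infty_iff_deriv.1 contDiff_cutoff).2

lemma contDiff_deriv_deriv_cutoff : ContDiff ℝ ∞ (deriv (deriv cutoff)) :=
  (contDiff_infty_iff_deriv.1 contDiff_deriv_cutoff).2

lemma hasDerivAt_cutoff (x : ℝ) : HasDerivAt cutoff (deriv cutoff x) x :=
  ((contDiff_infty_iff_deriv.1 contDiff_cutoff).1 x).hasDerivAt

lemma hasDerivAt_deriv_cutoff (x : ℝ) : HasDerivAt (deriv cutoff) (deriv (deriv cutoff) x) x :=
  ((contDiff_infty_iff_deriv.1 contDiff_deriv_cutoff).1 x).hasDerivAt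

section

variable {c : ℝ} {u u₁ u₂ : ℝ → ℝ}

lemma hasDerivWithinAt_comp_reflection
    (hu : ∀ x ∈ Ici (0 : ℝ), HasDerivWithinAt u (u₁ x) (Ici 0) x) {x : ℝ} (hx : x ∈ Iic (0 : ℝ)) :
    HasDerivWithinAt (fun x => u (reflection c x)) (u₁ (reflection c x) * reflection' c x)
      (Iic 0) x :=
  (hu _ (reflection_mapsTo c hx)).comp x (hasDerivAt_reflection c x).hasDerivWithinAt
    (reflection_mapsTo c)

lemma hasDerivWithinAt_reflected
    (hu : ∀ x ∈ Ici (0 : ℝ), HasDerivWithinAt u (u₁ x) (Ici 0) x) {x : ℝ} (hx : x ∈ Iic (0 : ℝ)) :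
    HasDerivWithinAt (reflected c u) (reflected' c u u₁ x) (Iic 0) x := by
  refine (show HasDerivWithinAt (reflected c u) _ (Iic 0) x from
    (hasDerivAt_cutoff x).hasDerivWithinAt.neg.mul
      (hasDerivWithinAt_comp_reflection (c := c) hu hx)).congr_deriv ?_
  simp only [reflected', Pi.neg_apply]
  ring

lemma hasDerivWithinAt_reflected'
    (hu : ∀ x ∈ Ici (0 : ℝ), HasDerivWithinAt u (u₁ x) (Ici 0) x)
    (hu₁ : ∀ x ∈ Ici (0 : ℝ), HasDerivWithinAt u₁ (u₂ x) (Ici 0) x)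
    {x : ℝ} (hx : x ∈ Iic (0 : ℝ)) :
    HasDerivWithinAt (reflected' c u u₁) (reflected'' c u u₁ u₂ x) (Iic 0) x := by
  refine (show HasDerivWithinAt (reflected' c u u₁) _ (Iic 0) x from
    ((hasDerivAt_deriv_cutoff x).hasDerivWithinAt.neg.mul
      (hasDerivWithinAt_comp_reflection (c := c) hu hx)).add
    (((hasDerivAt_cutoff x).mul (hasDerivAt_reflection' c x)).neg.hasDerivWithinAt.mul
      (hasDerivWithinAt_comp_reflection (c := c) hu₁ hx))).congr_deriv ?_
  simp only [reflected'', crossCoeff, Pi.neg_apply, Pi.mul_apply]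
  ring

lemma continuousOn_reflected'' (hu : ContinuousOn u (Ici 0)) (hu₁ : ContinuousOn u₁ (Ici 0))
    (hu₂ : ContinuousOn u₂ (Ici 0)) : ContinuousOn (reflected'' c u u₁ u₂) (Iic 0) := by
  have hcomp : ∀ {w : ℝ → ℝ}, ContinuousOn w (Ici 0) →
      ContinuousOn (fun x => w (reflection c x)) (Iic 0) := fun hw =>
    hw.comp (contDiff_reflection c).continuous.continuousOn (reflection_mapsTo c)
  have h0 := contDiff_cutoff.continuous
  have h1 := contDiff_deriv_cutoff.continuous
  have h2 := contDiff_deriv_deriv_cutoff.continuous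
  have h3 := (contDiff_reflection' c).continuous
  have h4 := (contDiff_reflection'' c).continuous
  have h5 : Continuous (crossCoeff c) := by unfold crossCoeff; fun_prop
  exact (((h2.neg.continuousOn).mul (hcomp hu)).add (h5.continuousOn.mul (hcomp hu₁))).add
    ((h0.mul (h3.pow 2)).neg.continuousOn.mul (hcomp hu₂))

lemma reflected_zero (hu : u 0 = 0) : u 0 = reflected c u 0 := by
  simp [reflected, reflection, hu]

lemma reflected'_zero (hu : u 0 = 0) : u₁ 0 = reflected' c u u₁ 0 := by
  simp [reflected', reflection, reflection', hu, cutoff_zero]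

lemma reflected''_zero (hu : u 0 = 0) (h : u₂ 0 + c * u₁ 0 = 0) :
    u₂ 0 = reflected'' c u u₁ u₂ 0 := by
  simp only [reflected'', crossCoeff, reflection, reflection', reflection'', cutoff_zero,
    deriv_cutoff_zero, hu, mul_zero, neg_zero, zero_mul, Real.exp_zero, mul_one]
  linear_combination 2 * h

/-! ### Estimates for the reflected function -/

/-- Simultaneous bounds for all coefficients occurring in the reflected function and its first two
derivatives. -/
structure CoeffBound_s11 (c B : ℝ) : Prop where
  reflection : LipBound B (reflection c)
  deriv_cutoff : LipBound B fun x => -deriv cutoff x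
  first : LipBound B fun x => -(cutoff x * reflection' c x)
  deriv_deriv_cutoff : LipBound B fun x => -deriv (deriv cutoff) x
  cross : LipBound B (crossCoeff c)
  second : LipBound B fun x => -(cutoff x * reflection' c x ^ 2)

lemma exists_coeffBound (c : ℝ) : ∃ B : ℝ, 1 ≤ B ∧ CoeffBound_s11 c B := by
  have le : (1 : WithTop ℕ∞) ≤ ∞ := by exact_mod_cast le_top
  have h0 := contDiff_cutoff.of_le le
  have h1 := contDiff_deriv_cutoff.of_le le
  have h2 := contDiff_deriv_deriv_cutoff.of_le le
  have h3 := (contDiff_reflection' c).of_le le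
  have h4 := (contDiff_reflection'' c).of_le le
  have h5 : ContDiff ℝ 1 (crossCoeff c) := by unfold crossCoeff; fun_prop
  refine Eventually.exists (f := atTop) ?_
  filter_upwards [eventually_ge_atTop 1, ((contDiff_reflection c).of_le le).eventually_lipBound,
    h1.neg.eventually_lipBound, (h0.mul h3).neg.eventually_lipBound, h2.neg.eventually_lipBound,
    h5.eventually_lipBound, (h0.mul (h3.pow 2)).neg.eventually_lipBound] with B a0 a1 a2 a3 a4 a5 a6
  exact ⟨a0, a1, a2, a3, a4, a5, a6⟩

lemma reflected'_of_le {x : ℝ} (hx : x ≤ -1) : reflected' c u u₁ x = 0 := by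
  simp [reflected', cutoff_of_le hx, deriv_cutoff_of_le hx]

lemma reflected''_of_le {x : ℝ} (hx : x ≤ -1) : reflected'' c u u₁ u₂ x = 0 := by
  simp [reflected'', crossCoeff, cutoff_of_le hx, deriv_cutoff_of_le hx,
    deriv_deriv_cutoff_of_le hx]

lemma abs_mul_le_of_lipBound {A w : ℝ → ℝ} {B M x : ℝ} (hA : LipBound B A)
    (hx : x ∈ Icc (-1 : ℝ) 0) (hw : |w (reflection c x)| ≤ M) :
    |A x * w (reflection c x)| ≤ B * M := by
  rw [abs_mul]
  exact mul_le_mul (hA x hx).1 hw (abs_nonneg _) ((abs_nonneg _).trans (hA x hx).1)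

lemma abs_reflected_le {M : ℝ} {x : ℝ} (hu : |u (reflection c x)| ≤ M) :
    |reflected c u x| ≤ M := by
  rw [reflected, abs_mul, abs_neg]
  exact (mul_le_of_le_one_left (abs_nonneg _) (abs_cutoff_le_one x)).trans hu

lemma abs_reflected'_le {B M : ℝ} (hB : CoeffBound_s11 c B) (hB0 : 0 ≤ B) (hM : 0 ≤ M)
    (hu : ∀ x ∈ Ici (0 : ℝ), |u x| ≤ M) (hu₁ : ∀ x ∈ Ici (0 : ℝ), |u₁ x| ≤ M)
    {x : ℝ} (hx : x ≤ 0) : |reflected' c u u₁ x| ≤ 2 * B * M := by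
  rcases le_total x (-1) with h | h
  · rw [reflected'_of_le h, abs_zero]
    positivity
  have hφ := reflection_mapsTo c hx
  refine (abs_add_le _ _).trans ?_
  linarith [abs_mul_le_of_lipBound hB.deriv_cutoff ⟨h, hx⟩ (hu _ hφ),
    abs_mul_le_of_lipBound hB.first ⟨h, hx⟩ (hu₁ _ hφ)]

lemma abs_reflected''_le {B M : ℝ} (hB : CoeffBound_s11 c B) (hB0 : 0 ≤ B) (hM : 0 ≤ M)
    (hu : ∀ x ∈ Ici (0 : ℝ), |u x| ≤ M) (hu₁ : ∀ x ∈ Ici (0 : ℝ), |u₁ x| ≤ M)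
    (hu₂ : ∀ x ∈ Ici (0 : ℝ), |u₂ x| ≤ M)
    {x : ℝ} (hx : x ≤ 0) : |reflected'' c u u₁ u₂ x| ≤ 3 * B * M := by
  rcases le_total x (-1) with h | h
  · rw [reflected''_of_le h, abs_zero]
    positivity
  have hφ := reflection_mapsTo c hx
  refine (abs_add_three _ _ _).trans ?_
  linarith [abs_mul_le_of_lipBound hB.deriv_deriv_cutoff ⟨h, hx⟩ (hu _ hφ),
    abs_mul_le_of_lipBound hB.cross ⟨h, hx⟩ (hu₁ _ hφ),
    abs_mul_le_of_lipBound hB.second ⟨h, hx⟩ (hu₂ _ hφ)]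

lemma abs_comp_reflection_sub_le_of_deriv {α B M : ℝ} (hα1 : α ≤ 1) (hB0 : 0 ≤ B)
    (hB : CoeffBound_s11 c B) (hM : 0 ≤ M)
    (hu : ∀ x ∈ Ici (0 : ℝ), HasDerivWithinAt u (u₁ x) (Ici 0) x)
    (hu₁ : ∀ x ∈ Ici (0 : ℝ), |u₁ x| ≤ M) :
    ∀ x ∈ Icc (-1 : ℝ) 0, ∀ y ∈ Icc (-1 : ℝ) 0,
      |u (reflection c x) - u (reflection c y)| ≤ M * B * |x - y| ^ α := by
  intro x hx y hy
  calc |u (reflection c x) - u (reflection c y)|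
      ≤ M * |reflection c x - reflection c y| :=
        (convex_Ici (0 : ℝ)).norm_image_sub_le_of_norm_hasDerivWithin_le hu hu₁
          (reflection_mapsTo c hy.2) (reflection_mapsTo c hx.2)
    _ ≤ M * (B * |x - y| ^ α) := by
        gcongr
        exact ((hB.reflection x hx).2 y hy).trans
          (mul_le_mul_of_nonneg_left (abs_le_rpow_of_mem_Icc hα1 hx hy) hB0)
    _ = M * B * |x - y| ^ α := by ring

lemma abs_comp_reflection_sub_le_of_holder {α M : ℝ≥0} {B : ℝ} (hα1 : α ≤ 1) (hB1 : 1 ≤ B)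
    (hB : CoeffBound_s11 c B) (hu : HolderOnWith M α u (Ici 0)) :
    ∀ x ∈ Icc (-1 : ℝ) 0, ∀ y ∈ Icc (-1 : ℝ) 0,
      |u (reflection c x) - u (reflection c y)| ≤ M * B * |x - y| ^ (α : ℝ) := by
  intro x hx y hy
  calc |u (reflection c x) - u (reflection c y)|
      ≤ M * |reflection c x - reflection c y| ^ (α : ℝ) :=
        hu.dist_le (reflection_mapsTo c hx.2) (reflection_mapsTo c hy.2)
    _ ≤ M * (B * |x - y|) ^ (α : ℝ) := by
        gcongr
        exact (hB.reflection x hx).2 y hy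
    _ = M * (B ^ (α : ℝ) * |x - y| ^ (α : ℝ)) := by
        rw [Real.mul_rpow (by linarith) (abs_nonneg _)]
    _ ≤ M * (B * |x - y| ^ (α : ℝ)) := by
        gcongr
        exact Real.rpow_le_self_of_one_le hB1 (by exact_mod_cast hα1)
    _ = M * B * |x - y| ^ (α : ℝ) := by ring

lemma abs_reflected''_sub_le {α M : ℝ≥0} {B : ℝ} (hα1 : α ≤ 1) (hB1 : 1 ≤ B)
    (hB : CoeffBound_s11 c B)
    (hu : ∀ x ∈ Ici (0 : ℝ), HasDerivWithinAt u (u₁ x) (Ici 0) x)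
    (hu₁ : ∀ x ∈ Ici (0 : ℝ), HasDerivWithinAt u₁ (u₂ x) (Ici 0) x)
    (b : ∀ x ∈ Ici (0 : ℝ), |u x| ≤ M) (b₁ : ∀ x ∈ Ici (0 : ℝ), |u₁ x| ≤ M)
    (b₂ : ∀ x ∈ Ici (0 : ℝ), |u₂ x| ≤ M) (hu₂ : HolderOnWith M α u₂ (Ici 0)) :
    ∀ x ∈ Iic (0 : ℝ), ∀ y ∈ Iic (0 : ℝ),
      |reflected'' c u u₁ u₂ x - reflected'' c u u₁ u₂ y| ≤
        (0 + 3 * (B * (M * B + M))) * |x - y| ^ (α : ℝ) := by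
  have hα1' : (α : ℝ) ≤ 1 := by exact_mod_cast hα1
  have hB0 : 0 ≤ B := by linarith
  have comp_le : ∀ {w : ℝ → ℝ}, (∀ x ∈ Ici (0 : ℝ), |w x| ≤ M) →
      ∀ x ∈ Icc (-1 : ℝ) 0, |w (reflection c x)| ≤ M :=
    fun hw x hx => hw _ (reflection_mapsTo c hx.2)
  refine abs_sub_le_of_Iic_of_Ici (p := -1) α.coe_nonneg le_rfl (by positivity) (by simp) ?_ ?_
  · rintro x ⟨-, hx⟩ y ⟨-, hy⟩
    simp [reflected''_of_le hx, reflected''_of_le hy]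
  · rintro x ⟨hx0, hx⟩ y ⟨hy0, hy⟩
    have hx' : x ∈ Icc (-1 : ℝ) 0 := ⟨hx, hx0⟩
    have hy' : y ∈ Icc (-1 : ℝ) 0 := ⟨hy, hy0⟩
    have e₀ := hB.deriv_deriv_cutoff.abs_mul_sub_mul_le hα1' (comp_le b)
      (abs_comp_reflection_sub_le_of_deriv hα1' hB0 hB M.coe_nonneg hu b₁) hx' hy'
    have e₁ := hB.cross.abs_mul_sub_mul_le hα1' (comp_le b₁)
      (abs_comp_reflection_sub_le_of_deriv hα1' hB0 hB M.coe_nonneg hu₁ b₂) hx' hy'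
    have e₂ := hB.second.abs_mul_sub_mul_le hα1' (comp_le b₂)
      (abs_comp_reflection_sub_le_of_holder hα1 hB1 hB hu₂) hx' hy'
    rw [reflected'', reflected'', add_sub_add_comm, add_sub_add_comm]
    refine (abs_add_three _ _ _).trans ?_
    linarith

end

/-! ### Bounds for functions in `X₁` -/

lemma exists_abs_le_of_eventually_zero {w : ℝ → ℝ} {C : ℝ} (hw : ContinuousOn w (Ici 0))
    (h0 : ∀ x, C < x → w x = 0) : ∃ D : ℝ, ∀ x ∈ Ici (0 : ℝ), |w x| ≤ D := by
  obtain ⟨D, hD⟩ := isCompact_Icc.exists_bound_of_continuousOn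
    (hw.mono (Icc_subset_Ici_self : Icc 0 C ⊆ Ici 0))
  refine ⟨max D 0, fun x hx => ?_⟩
  rcases le_or_gt x C with h | h
  · exact (hD x ⟨hx, h⟩).trans (le_max_left _ _)
  · rw [h0 x h, abs_zero]
    exact le_max_right _ _

lemma derivWithin_eq_zero_of_lt {w : ℝ → ℝ} {C : ℝ} (hC : 0 < C) (h0 : ∀ x, C < x → w x = 0) :
    ∀ x, C < x → derivWithin w (Ici 0) x = 0 := fun x hx => by
  rw [derivWithin_of_mem_nhds (Ici_mem_nhds (hC.trans hx))]
  have : w =ᶠ[𝓝 x] fun _ => 0 := by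
    filter_upwards [Ioi_mem_nhds hx] with y hy using h0 y hy
  simpa using this.deriv_eq

/-- Lemma 3.6, extension operator in one dimension. For `a > 0`,
`b ∈ ℝ` there are `δ > 0` and a continuous linear extension operator
`E : X₁ → C_c^{2,α}(ℝ)` with `Eu = u` on `[0, ∞)`, `supp(Eu) ⊆ [−δ, ∞)` and
`‖Eu‖_{C⁰(ℝ)} = ‖u‖_{C⁰(ℝ₀⁺)}`. -/
theorem one_dimensional_extension_operator
    (α : ℝ≥0) (hα0 : 0 < α) (hα1 : α ≤ 1) (a b : ℝ) (ha : 0 < a) :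
    ∃ δ : ℝ, 0 < δ ∧
    ∃ E : (ℝ → ℝ) → (ℝ → ℝ), ∃ K : ℝ≥0,
      -- linearity on `X₁`
      (∀ u v : ℝ → ℝ, MemX1 α a b u → MemX1 α a b v →
        ∀ x : ℝ, E (u + v) x = E u x + E v x) ∧
      (∀ (r : ℝ) (u : ℝ → ℝ), MemX1 α a b u → ∀ x : ℝ, E (r • u) x = r * E u x) ∧
      (∀ u : ℝ → ℝ, MemX1 α a b u →
        -- `Eu` extends `u`
        EqOn (E u) u (Ici 0) ∧
        -- `Eu ∈ C_c^{2,α}(ℝ)` with support in `[−δ, ∞)`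
        HasCompactSupport (E u) ∧ tsupport (E u) ⊆ Ici (-δ) ∧
        ContDiff ℝ 2 (E u) ∧
        (∃ C : ℝ≥0, HolderWith C α (deriv (deriv (E u)))) ∧
        -- the sup-norm is preserved
        sSup ((fun x => |E u x|) '' univ) = sSup ((fun x => |u x|) '' Ici 0) ∧
        -- continuity of `E` w.r.t. the `C^{2,α}`-norms
        (∀ M : ℝ≥0,
          ((∀ x ∈ Ici (0 : ℝ),
              |u x| ≤ (M : ℝ) ∧ |derivWithin u (Ici 0) x| ≤ (M : ℝ) ∧
              |derivWithin (derivWithin u (Ici 0)) (Ici 0) x| ≤ (M : ℝ)) ∧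
            HolderOnWith M α
              (derivWithin (derivWithin u (Ici 0)) (Ici 0)) (Ici 0)) →
          ((∀ x : ℝ,
              |E u x| ≤ (K * M : ℝ≥0) ∧ |deriv (E u) x| ≤ (K * M : ℝ≥0) ∧
              |deriv (deriv (E u)) x| ≤ (K * M : ℝ≥0)) ∧
            HolderWith (K * M) α (deriv (deriv (E u)))))) := by
  obtain ⟨B, hB1, hB⟩ := exists_coeffBound (b / a)
  have hB0 : 0 ≤ B := by linarith
  set K : ℝ≥0 := ⟨3 * (B * (B + 1)) + 1, by positivity⟩
  have hKB : (K : ℝ) = 3 * (B * (B + 1)) + 1 := rfl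
  refine ⟨1, one_pos, fun u => glue u (reflected (b / a) u), K, ?_, ?_, ?_⟩
  · intro u v _ _ x
    by_cases hx : 0 ≤ x
    · simp [glue, hx]
    · simp only [glue, hx, if_false, reflected, Pi.add_apply]
      ring
  · intro r u _ x
    by_cases hx : 0 ≤ x
    · simp [glue, hx]
    · simp only [glue, hx, if_false, reflected, Pi.smul_apply, smul_eq_mul]
      ring
  rintro u ⟨hu, ⟨H, hH⟩, hu0, hbc, C, hC, hsupp⟩
  set c := b / a with hc
  set u₁ := derivWithin u (Ici 0)
  set u₂ := derivWithin u₁ (Ici 0)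
  obtain ⟨hd, -, hd'⟩ := (contDiffOn_succ_iff_derivWithin (n := 1) (uniqueDiffOn_Ici 0)).1 hu
  have D₁ : ∀ x ∈ Ici (0 : ℝ), HasDerivWithinAt u (u₁ x) (Ici 0) x :=
    fun x hx => (hd x hx).hasDerivWithinAt
  have D₂ : ∀ x ∈ Ici (0 : ℝ), HasDerivWithinAt u₁ (u₂ x) (Ici 0) x :=
    fun x hx => (hd'.differentiableOn one_ne_zero x hx).hasDerivWithinAt
  have cont₂ : ContinuousOn u₂ (Ici 0) := hH.continuousOn hα0
  have z₀ := reflected_zero (c := c) hu0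
  have z₁ := reflected'_zero (c := c) (u₁ := u₁) hu0
  have z₂ := reflected''_zero (c := c) (u₁ := u₁) (u₂ := u₂) hu0 (by
    rw [hc]
    field_simp
    linarith)
  have E₁ := hasDerivAt_glue D₁ (fun x hx => hasDerivWithinAt_reflected (c := c) D₁ hx) z₀ z₁
  have E₂ := hasDerivAt_glue D₂ (fun x hx => hasDerivWithinAt_reflected' (c := c) D₁ D₂ hx) z₁ z₂
  have dE₁ : deriv (glue u (reflected c u)) = glue u₁ (reflected' c u u₁) :=
    funext fun x => (E₁ x).deriv
  have dE₂ : deriv (glue u₁ (reflected' c u u₁)) = glue u₂ (reflected'' c u u₁ u₂) :=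
    funext fun x => (E₂ x).deriv
  have estimate : ∀ M : ℝ≥0, ((∀ x ∈ Ici (0 : ℝ), |u x| ≤ M ∧ |u₁ x| ≤ M ∧ |u₂ x| ≤ M) ∧
      HolderOnWith M α u₂ (Ici 0)) →
      (∀ x : ℝ, |glue u (reflected c u) x| ≤ (K * M : ℝ≥0) ∧
        |deriv (glue u (reflected c u)) x| ≤ (K * M : ℝ≥0) ∧
        |deriv (deriv (glue u (reflected c u))) x| ≤ (K * M : ℝ≥0)) ∧
      HolderWith (K * M) α (deriv (deriv (glue u (reflected c u)))) := by
    rintro M ⟨hM, hMH⟩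
    rw [dE₁, dE₂]
    have b₀ := fun x hx => (hM x hx).1
    have b₁ := fun x hx => (hM x hx).2.1
    have b₂ := fun x hx => (hM x hx).2.2
    have M0 : (0 : ℝ) ≤ M := M.coe_nonneg
    have BM : 0 ≤ B * M := by positivity
    have BBM : 0 ≤ B * (B * M) := by positivity
    have hKM : ((K * M : ℝ≥0) : ℝ) = 3 * (B * (B * M)) + 3 * (B * M) + M := by
      rw [NNReal.coe_mul, hKB]
      ring
    refine ⟨fun x => ?_, ?_⟩
    · rw [hKM]
      rcases le_total 0 x with hx | hx
      · rw [glue_of_nonneg _ _ hx, glue_of_nonneg _ _ hx, glue_of_nonneg _ _ hx]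
        exact ⟨by linarith [b₀ x hx], by linarith [b₁ x hx], by linarith [b₂ x hx]⟩
      · rw [glue_of_nonpos z₀ hx, glue_of_nonpos z₁ hx, glue_of_nonpos z₂ hx]
        exact ⟨by linarith [abs_reflected_le (b₀ _ (reflection_mapsTo c hx))],
          by linarith [abs_reflected'_le hB hB0 M0 b₀ b₁ hx],
          by linarith [abs_reflected''_le hB hB0 M0 b₀ b₁ b₂ hx]⟩
    · rw [← holderOnWith_univ]
      refine holderOnWith_of_abs_sub_le ?_
      rw [show ((K * M : ℝ≥0) : ℝ) = (0 + 3 * (B * (M * B + M))) + M by rw [hKM]; ring]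
      refine abs_sub_le_of_Iic_of_Ici (p := 0) α.coe_nonneg (by positivity) M0 (mem_univ _) ?_ ?_
      · rintro x ⟨-, hx⟩ y ⟨-, hy⟩
        rw [glue_of_nonpos z₂ hx, glue_of_nonpos z₂ hy]
        exact abs_reflected''_sub_le hα1 hB1 hB D₁ D₂ b₀ b₁ b₂ hMH x hx y hy
      · rintro x ⟨-, hx⟩ y ⟨-, hy⟩
        rw [glue_of_nonneg _ _ hx, glue_of_nonneg _ _ hy]
        exact hMH.dist_le hx hy
  have supp₁ := derivWithin_eq_zero_of_lt hC hsupp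
  obtain ⟨M₀, hM₀⟩ := exists_abs_le_of_eventually_zero hu.continuousOn hsupp
  obtain ⟨M₁, hM₁⟩ := exists_abs_le_of_eventually_zero hd'.continuousOn supp₁
  obtain ⟨M₂, hM₂⟩ := exists_abs_le_of_eventually_zero cont₂ (derivWithin_eq_zero_of_lt hC supp₁)
  have zero_left : ∀ x, x < -1 → glue u (reflected c u) x = 0 := fun x hx => by
    rw [glue_of_nonpos z₀ (by linarith), reflected, cutoff_of_le hx.le]
    simp
  refine ⟨fun x hx => glue_of_nonneg _ _ hx, ?_, ?_, ?_, ?_, ?_, estimate⟩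
  · refine HasCompactSupport.intro (isCompact_Icc (a := -1) (b := C)) fun x hx => ?_
    rcases lt_or_ge x (-1) with h | h
    · exact zero_left x h
    · have hCx : C < x := not_le.1 fun h' => hx ⟨h, h'⟩
      exact (glue_of_nonneg _ _ (hC.trans hCx).le).trans (hsupp x hCx)
  · refine closure_minimal (fun x hx => ?_) isClosed_Ici
    exact not_lt.1 fun h => hx (zero_left x h)
  · refine (contDiff_succ_iff_deriv (n := 1)).2
      ⟨fun x => (E₁ x).differentiableAt, by simp, ?_⟩
    rw [dE₁, contDiff_one_iff_deriv, dE₂]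
    exact ⟨fun x => (E₂ x).differentiableAt, continuous_glue cont₂
      (continuousOn_reflected'' hu.continuousOn hd'.continuousOn cont₂) z₂⟩
  · set M : ℝ≥0 := H + M₀.toNNReal + M₁.toNNReal + M₂.toNNReal with hM
    have hM' : (M : ℝ) = H + max M₀ 0 + max M₁ 0 + max M₂ 0 := by
      simp [hM, Real.coe_toNNReal']
    have h0 := H.coe_nonneg
    refine ⟨K * M, (estimate M ⟨fun x hx => ?_, hH.mono_const ?_⟩).2⟩
    · have := hM₀ x hx
      have := hM₁ x hx
      have := hM₂ x hx
      have := le_max_left M₀ 0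
      have := le_max_right M₀ 0
      have := le_max_left M₁ 0
      have := le_max_right M₁ 0
      have := le_max_left M₂ 0
      have := le_max_right M₂ 0
      rw [hM']
      exact ⟨by linarith, by linarith, by linarith⟩
    · rw [hM, add_assoc, add_assoc]
      exact le_self_add
  · have bdd : BddAbove ((fun x => |u x|) '' Ici 0) :=
      ⟨M₀, by rintro _ ⟨x, hx, rfl⟩; exact hM₀ x hx⟩
    have le : ∀ x ∈ Ici (0 : ℝ), |u x| ≤ sSup ((fun x => |u x|) '' Ici 0) :=
      fun x hx => le_csSup bdd (mem_image_of_mem _ hx)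
    have le' : ∀ x, |glue u (reflected c u) x| ≤ sSup ((fun x => |u x|) '' Ici 0) := fun x => by
      rcases le_total 0 x with hx | hx
      · rw [glue_of_nonneg _ _ hx]
        exact le x hx
      · rw [glue_of_nonpos z₀ hx]
        exact abs_reflected_le (le _ (reflection_mapsTo c hx))
    refine le_antisymm (csSup_le (univ_nonempty.image _) ?_) (csSup_le (nonempty_Ici.image _) ?_)
    · rintro _ ⟨x, -, rfl⟩
      exact le' x
    · rintro _ ⟨x, hx, rfl⟩
      refine le_csSup ⟨_, by rintro _ ⟨x, -, rfl⟩; exact le' x⟩ ⟨x, mem_univ x, ?_⟩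
      simp only [glue_of_nonneg _ _ hx]
end
end

section
/- Let R > 0, Q = [−R, R]ⁿ, Q^{0,+} = [−R, R]^{n−1} × [0, R]. Let L be a uniformly elliptic second-order operator with coefficients a_{ij}, b_i ∈ C^{2,α}(Q^{0,+}), ellipticity constant λ > 0 and coefficient bound Λ, and assume L has no mixed normal terms on the flat boundary: a_{in}(x) = 0 for all i < n and all x with x_n = 0. Let X₁ = {u ∈ C^{2,α}(Q^{0,+}) : u(x) = 0 and (Lu)(x) = 0 for all x with x_n = 0}. Then there exists a continuous linear extension operator E : X₁ → C^{2,α}(Q) with Eu = u on Q^{0,+} and ‖Eu‖_{C⁰(Q)} = ‖u‖_{C⁰(Q^{0,+})} for all u ∈ X₁. -/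
open scoped NNReal Topology
open Set Metric

noncomputable section

/-- Partial derivative within a set `s`, in coordinate direction `i`. -/
def pdW {n : ℕ} (s : Set (EuclideanSpace ℝ (Fin n))) (i : Fin n)
    (u : EuclideanSpace ℝ (Fin n) → ℝ) (x : EuclideanSpace ℝ (Fin n)) : ℝ :=
  fderivWithin ℝ u s x (EuclideanSpace.single i 1)

/-- The second-order elliptic operator `Lu = Σ aᵢⱼ ∂ᵢ∂ⱼ u + Σ bᵢ ∂ᵢ u + c·u`,
with derivatives taken within `s`. -/
def LopW {n : ℕ} (s : Set (EuclideanSpace ℝ (Fin n)))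
    (a : Fin n → Fin n → EuclideanSpace ℝ (Fin n) → ℝ)
    (b : Fin n → EuclideanSpace ℝ (Fin n) → ℝ)
    (c : EuclideanSpace ℝ (Fin n) → ℝ)
    (u : EuclideanSpace ℝ (Fin n) → ℝ) (x : EuclideanSpace ℝ (Fin n)) : ℝ :=
  (∑ i, ∑ j, a i j x * pdW s i (pdW s j u) x) + (∑ i, b i x * pdW s i u x) + c x * u x

/-- `f ∈ C^{0,α}(s)`: `f` is `α`-Hölder continuous on `s`. -/
def MemC0α {n : ℕ} (α : ℝ≥0) (f : EuclideanSpace ℝ (Fin n) → ℝ)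
    (s : Set (EuclideanSpace ℝ (Fin n))) : Prop :=
  ∃ C : ℝ≥0, HolderOnWith C α f s

/-- `u ∈ C^{2,α}(s)`: `u` is twice continuously differentiable on `s` and its second
derivative is `α`-Hölder continuous on `s`. -/
def MemC2α {n : ℕ} (α : ℝ≥0) (u : EuclideanSpace ℝ (Fin n) → ℝ)
    (s : Set (EuclideanSpace ℝ (Fin n))) : Prop :=
  ContDiffOn ℝ 2 u s ∧ ∃ C : ℝ≥0, HolderOnWith C α (iteratedFDerivWithin ℝ 2 u s) s

/-- Uniform ellipticity of the coefficient matrix `(aᵢⱼ)` on `s` with constant `lam`. -/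
def UnifElliptic {n : ℕ} (a : Fin n → Fin n → EuclideanSpace ℝ (Fin n) → ℝ) (lam : ℝ)
    (s : Set (EuclideanSpace ℝ (Fin n))) : Prop :=
  ∀ x ∈ s, ∀ ξ : EuclideanSpace ℝ (Fin n), lam * ‖ξ‖ ^ 2 ≤ ∑ i, ∑ j, a i j x * ξ i * ξ j

/-- All coefficients are bounded by `Λ` on `s`. -/
def CoeffBound {n : ℕ} (a : Fin n → Fin n → EuclideanSpace ℝ (Fin n) → ℝ)
    (b : Fin n → EuclideanSpace ℝ (Fin n) → ℝ)
    (c : EuclideanSpace ℝ (Fin n) → ℝ) (Lam : ℝ)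
    (s : Set (EuclideanSpace ℝ (Fin n))) : Prop :=
  ∀ x ∈ s, (∀ i j, |a i j x| ≤ Lam) ∧ (∀ i, |b i x| ≤ Lam) ∧ |c x| ≤ Lam

/-- Supremum norm of `u` over the set `s`. -/
def supNormOn {n : ℕ} (u : EuclideanSpace ℝ (Fin n) → ℝ)
    (s : Set (EuclideanSpace ℝ (Fin n))) : ℝ :=
  sSup ((fun x => |u x|) '' s)

set_option maxSynthPendingDepth 3
set_option linter.unusedSectionVars false

/-- `f` is bounded by `C` and `α`-Hölder continuous with constant `C` on `s`. -/
structure BddHolder {E F : Type*} [NormedAddCommGroup E] [NormedAddCommGroup F]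
    (α : ℝ) (s : Set E) (f : E → F) (C : ℝ) : Prop where
  bound : ∀ x ∈ s, ‖f x‖ ≤ C
  holder : ∀ x ∈ s, ∀ y ∈ s, ‖f x - f y‖ ≤ C * ‖x - y‖ ^ α

/-- `f` has derivative `df` within `s`, and both are bounded and Hölder continuous. -/
structure HasC1Holder {E F : Type*} [NormedAddCommGroup E] [NormedSpace ℝ E]
    [NormedAddCommGroup F] [NormedSpace ℝ F]
    (α : ℝ) (s : Set E) (f : E → F) (df : E → E →L[ℝ] F) (C : ℝ) : Prop where
  hasFDeriv : ∀ x ∈ s, HasFDerivWithinAt f (df x) s x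
  base : BddHolder α s f C
  deriv : BddHolder α s df C

/-- `f` has first and second derivatives `f₁`, `f₂` within `s`, all bounded and Hölder
continuous. -/
structure HasC2Holder {E F : Type*} [NormedAddCommGroup E] [NormedSpace ℝ E]
    [NormedAddCommGroup F] [NormedSpace ℝ F]
    (α : ℝ) (s : Set E) (f : E → F) (f₁ : E → E →L[ℝ] F) (f₂ : E → E →L[ℝ] E →L[ℝ] F)
    (C : ℝ) : Prop where
  fst : HasC1Holder α s f f₁ C
  snd : HasC1Holder α s f₁ f₂ C

/-- Membership in `C^{2,α}(s)`, formulated with existentially quantified derivatives. -/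
def IsC2Holder {E F : Type*} [NormedAddCommGroup E] [NormedSpace ℝ E]
    [NormedAddCommGroup F] [NormedSpace ℝ F] (α : ℝ) (s : Set E) (f : E → F) : Prop :=
  ∃ f₁ f₂ C, 0 ≤ C ∧ HasC2Holder α s f f₁ f₂ C

section Calculus

variable {E F G H : Type*} [NormedAddCommGroup E] [NormedSpace ℝ E]
  [NormedAddCommGroup F] [NormedSpace ℝ F] [NormedAddCommGroup G] [NormedSpace ℝ G]
  [NormedAddCommGroup H] [NormedSpace ℝ H] {α : ℝ} {s : Set E} {t : Set F}

theorem BddHolder.mono {f : E → F} {C D : ℝ} (h : BddHolder α s f C) (hCD : C ≤ D) :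
    BddHolder α s f D :=
  ⟨fun x hx => (h.bound x hx).trans hCD, fun x hx y hy => (h.holder x hx y hy).trans <| by
    gcongr⟩

theorem BddHolder.add {f g : E → F} {C D : ℝ} (hf : BddHolder α s f C)
    (hg : BddHolder α s g D) : BddHolder α s (fun x => f x + g x) (C + D) := by
  refine ⟨fun x hx => norm_add_le_of_le (hf.bound x hx) (hg.bound x hx), fun x hx y hy => ?_⟩
  rw [add_sub_add_comm, add_mul]
  exact norm_add_le_of_le (hf.holder x hx y hy) (hg.holder x hx y hy)

theorem BddHolder.bilin (B : F →L[ℝ] G →L[ℝ] H) {f : E → F} {g : E → G} {C D : ℝ}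
    (hC : 0 ≤ C) (hD : 0 ≤ D) (hf : BddHolder α s f C) (hg : BddHolder α s g D) :
    BddHolder α s (fun x => B (f x) (g x)) (2 * ‖B‖ * (C * D)) := by
  refine ⟨fun x hx => ?_, fun x hx y hy => ?_⟩
  · calc ‖B (f x) (g x)‖ ≤ ‖B‖ * ‖f x‖ * ‖g x‖ := B.le_opNorm₂ _ _
      _ ≤ ‖B‖ * C * D := by gcongr; exacts [hf.bound x hx, hg.bound x hx]
      _ ≤ 2 * ‖B‖ * (C * D) := by
        have : 0 ≤ ‖B‖ * C * D := by positivity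
        linarith
  · have e : B (f x) (g x) - B (f y) (g y) = B (f x - f y) (g x) + B (f y) (g x - g y) := by
      simp
    rw [e]
    calc _ ≤ ‖B‖ * ‖f x - f y‖ * ‖g x‖ + ‖B‖ * ‖f y‖ * ‖g x - g y‖ :=
          norm_add_le_of_le (B.le_opNorm₂ _ _) (B.le_opNorm₂ _ _)
      _ ≤ ‖B‖ * (C * ‖x - y‖ ^ α) * D + ‖B‖ * C * (D * ‖x - y‖ ^ α) := by
        gcongr
        exacts [hf.holder x hx y hy, hg.bound x hx, hf.bound y hy, hg.holder x hx y hy]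
      _ = _ := by ring

theorem BddHolder.comp (hα : 0 ≤ α) {f : F → G} {φ : E → F} {C L : ℝ} (hC : 0 ≤ C) (hL : 0 ≤ L)
    (hf : BddHolder α t f C) (hφ : MapsTo φ s t)
    (hφL : ∀ x ∈ s, ∀ y ∈ s, ‖φ x - φ y‖ ≤ L * ‖x - y‖) :
    BddHolder α s (fun x => f (φ x)) (C * (1 + L ^ α)) := by
  have hLα : 0 ≤ L ^ α := Real.rpow_nonneg hL _
  refine ⟨fun x hx => (hf.bound _ (hφ hx)).trans ?_, fun x hx y hy => ?_⟩
  · nlinarith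
  · calc ‖f (φ x) - f (φ y)‖ ≤ C * ‖φ x - φ y‖ ^ α := hf.holder _ (hφ hx) _ (hφ hy)
      _ ≤ C * (L * ‖x - y‖) ^ α := by
        gcongr
        exact hφL x hx y hy
      _ = C * (L ^ α) * ‖x - y‖ ^ α := by rw [Real.mul_rpow hL (norm_nonneg _)]; ring
      _ ≤ C * (1 + L ^ α) * ‖x - y‖ ^ α := by gcongr; linarith

theorem HasC1Holder.mono {f : E → F} {f' : E → E →L[ℝ] F} {C D : ℝ}
    (h : HasC1Holder α s f f' C) (hCD : C ≤ D) : HasC1Holder α s f f' D :=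
  ⟨h.hasFDeriv, h.base.mono hCD, h.deriv.mono hCD⟩

theorem HasC1Holder.add {f g : E → F} {f' g' : E → E →L[ℝ] F} {C D : ℝ}
    (hf : HasC1Holder α s f f' C) (hg : HasC1Holder α s g g' D) :
    HasC1Holder α s (fun x => f x + g x) (fun x => f' x + g' x) (C + D) :=
  ⟨fun x hx => (hf.hasFDeriv x hx).add (hg.hasFDeriv x hx), hf.base.add hg.base,
    hf.deriv.add hg.deriv⟩

theorem HasC1Holder.bilin (B : F →L[ℝ] G →L[ℝ] H) {f : E → F} {g : E → G}
    {f' : E → E →L[ℝ] F} {g' : E → E →L[ℝ] G} {C D : ℝ} (hC : 0 ≤ C) (hD : 0 ≤ D)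
    (hf : HasC1Holder α s f f' C) (hg : HasC1Holder α s g g' D) :
    HasC1Holder α s (fun x => B (f x) (g x))
      (fun x => B.precompR E (f x) (g' x) + B.precompL E (f' x) (g x))
      ((2 * ‖B‖ + 2 * ‖B.precompR E‖ + 2 * ‖B.precompL E‖) * (C * D)) := by
  have h0 : 0 ≤ ‖B‖ * (C * D) := by positivity
  have h1 : 0 ≤ ‖B.precompR E‖ * (C * D) := by positivity
  have h2 : 0 ≤ ‖B.precompL E‖ * (C * D) := by positivity
  refine ⟨fun x hx => B.hasFDerivWithinAt_of_bilinear (hf.hasFDeriv x hx) (hg.hasFDeriv x hx),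
    (BddHolder.bilin B hC hD hf.base hg.base).mono (by nlinarith),
    ((BddHolder.bilin (B.precompR E) hC hD hf.base hg.deriv).add
      (BddHolder.bilin (B.precompL E) hC hD hf.deriv hg.base)).mono (by nlinarith)⟩

theorem HasC1Holder.lipschitz (hs : Convex ℝ s) {f : E → F} {f' : E → E →L[ℝ] F} {C : ℝ}
    (h : HasC1Holder α s f f' C) :
    ∀ x ∈ s, ∀ y ∈ s, ‖f x - f y‖ ≤ C * ‖x - y‖ := fun _ hx _ hy =>
  hs.norm_image_sub_le_of_norm_hasFDerivWithin_le h.hasFDeriv h.deriv.bound hy hx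

theorem HasC1Holder.comp (hα : 0 ≤ α) (hs : Convex ℝ s) {f : F → G} {f' : F → F →L[ℝ] G}
    {φ : E → F} {φ' : E → E →L[ℝ] F} {C D : ℝ} (hC : 0 ≤ C) (hD : 0 ≤ D)
    (hf : HasC1Holder α t f f' C) (hφ : HasC1Holder α s φ φ' D) (hφt : MapsTo φ s t) :
    HasC1Holder α s (fun x => f (φ x))
      (fun x => ContinuousLinearMap.compL ℝ E F G (f' (φ x)) (φ' x))
      ((1 + 2 * ‖ContinuousLinearMap.compL ℝ E F G‖ * D) * (1 + D ^ α) * C) := by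
  have hDα : 0 ≤ D ^ α := Real.rpow_nonneg hD _
  have hlip := hφ.lipschitz hs
  have h0 : 0 ≤ (1 + D ^ α) * C := by positivity
  have h1 : 0 ≤ ‖ContinuousLinearMap.compL ℝ E F G‖ * D * ((1 + D ^ α) * C) := by positivity
  refine ⟨fun x hx => (hf.hasFDeriv _ (hφt hx)).comp x (hφ.hasFDeriv x hx) hφt,
    (hf.base.comp hα hC hD hφt hlip).mono (by nlinarith),
    (BddHolder.bilin _ (by positivity) hD (hf.deriv.comp hα hC hD hφt hlip) hφ.deriv).mono
      (by nlinarith)⟩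

theorem HasC2Holder.mono {f : E → F} {f₁ : E → E →L[ℝ] F} {f₂ : E → E →L[ℝ] E →L[ℝ] F}
    {C D : ℝ} (h : HasC2Holder α s f f₁ f₂ C) (hCD : C ≤ D) : HasC2Holder α s f f₁ f₂ D :=
  ⟨h.fst.mono hCD, h.snd.mono hCD⟩

theorem HasC2Holder.add {f g : E → F} {f₁ g₁ : E → E →L[ℝ] F}
    {f₂ g₂ : E → E →L[ℝ] E →L[ℝ] F} {C D : ℝ}
    (hf : HasC2Holder α s f f₁ f₂ C) (hg : HasC2Holder α s g g₁ g₂ D) :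
    HasC2Holder α s (fun x => f x + g x) (fun x => f₁ x + g₁ x) (fun x => f₂ x + g₂ x) (C + D) :=
  ⟨hf.fst.add hg.fst, hf.snd.add hg.snd⟩

theorem BddHolder.const_smul {f : E → F} {C : ℝ} (hf : BddHolder α s f C) (r : ℝ) :
    BddHolder α s (fun x => r • f x) (|r| * C) := by
  refine ⟨fun x hx => ?_, fun x hx y hy => ?_⟩
  · rw [norm_smul, Real.norm_eq_abs]
    gcongr
    exact hf.bound x hx
  · rw [← smul_sub, norm_smul, Real.norm_eq_abs, mul_assoc]
    gcongr
    exact hf.holder x hx y hy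

theorem HasC1Holder.const_smul {f : E → F} {f' : E → E →L[ℝ] F} {C : ℝ}
    (hf : HasC1Holder α s f f' C) (r : ℝ) :
    HasC1Holder α s (fun x => r • f x) (fun x => r • f' x) (|r| * C) :=
  ⟨fun x hx => (hf.hasFDeriv x hx).const_smul r, hf.base.const_smul r, hf.deriv.const_smul r⟩

theorem HasC2Holder.const_smul {f : E → F} {f₁ : E → E →L[ℝ] F}
    {f₂ : E → E →L[ℝ] E →L[ℝ] F} {C : ℝ} (hf : HasC2Holder α s f f₁ f₂ C) (r : ℝ) :
    HasC2Holder α s (fun x => r • f x) (fun x => r • f₁ x) (fun x => r • f₂ x) (|r| * C) :=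
  ⟨hf.fst.const_smul r, hf.snd.const_smul r⟩

/-- Composition with a fixed `C^{2,α}` map is bounded for the `C^{2,α}`-norms. -/
theorem IsC2Holder.exists_comp_bound (hα : 0 ≤ α) (hs : Convex ℝ s) {φ : E → F}
    (hφ : IsC2Holder α s φ) (hφt : MapsTo φ s t) :
    ∃ K, 0 ≤ K ∧ ∀ (f : F → G) (f₁ : F → F →L[ℝ] G) (f₂ : F → F →L[ℝ] F →L[ℝ] G) (C : ℝ), 0 ≤ C →
      HasC2Holder α t f f₁ f₂ C → ∃ g₁ g₂, HasC2Holder α s (fun x => f (φ x)) g₁ g₂ (K * C) := by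
  obtain ⟨φ₁, φ₂, D, hD, hφ⟩ := hφ
  have hDα : 0 ≤ D ^ α := Real.rpow_nonneg hD _
  set B := ContinuousLinearMap.compL ℝ E F G
  set K₁ := (1 + 2 * ‖B‖ * D) * (1 + D ^ α)
  set K₂ := (1 + 2 * ‖ContinuousLinearMap.compL ℝ E F (F →L[ℝ] G)‖ * D) * (1 + D ^ α)
  set K₃ := 2 * ‖B‖ + 2 * ‖B.precompR E‖ + 2 * ‖B.precompL E‖
  refine ⟨K₁ + K₃ * (K₂ * D), by positivity, fun f f₁ f₂ C hC hf =>
    ⟨fun x => B (f₁ (φ x)) (φ₁ x), fun x => B.precompR E (f₁ (φ x)) (φ₂ x) + B.precompL E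
      (ContinuousLinearMap.compL ℝ E F (F →L[ℝ] G) (f₂ (φ x)) (φ₁ x)) (φ₁ x), ?_, ?_⟩⟩
  · exact (HasC1Holder.comp hα hs hC hD hf.fst hφ.fst hφt).mono <| by
      have : 0 ≤ K₃ * (K₂ * D) * C := by positivity
      linarith
  · exact (HasC1Holder.bilin B (by positivity) hD
      (HasC1Holder.comp hα hs hC hD hf.snd hφ.fst hφt) hφ.snd).mono <| by
      have : 0 ≤ K₁ * C := by positivity
      change K₃ * (K₂ * C * D) ≤ _
      linarith

theorem IsC2Holder.comp (hα : 0 ≤ α) (hs : Convex ℝ s) {f : F → G} {φ : E → F}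
    (hf : IsC2Holder α t f) (hφ : IsC2Holder α s φ) (hφt : MapsTo φ s t) :
    IsC2Holder α s (fun x => f (φ x)) := by
  obtain ⟨f₁, f₂, C, hC, hf⟩ := hf
  obtain ⟨K, hK, h⟩ := hφ.exists_comp_bound (G := G) hα hs hφt
  obtain ⟨g₁, g₂, hg⟩ := h f f₁ f₂ C hC hf
  exact ⟨g₁, g₂, _, by positivity, hg⟩

theorem IsC2Holder.add {f g : E → F} (hf : IsC2Holder α s f) (hg : IsC2Holder α s g) :
    IsC2Holder α s (fun x => f x + g x) := by
  obtain ⟨f₁, f₂, C, hC, hf⟩ := hf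
  obtain ⟨g₁, g₂, D, hD, hg⟩ := hg
  exact ⟨_, _, _, add_nonneg hC hD, hf.add hg⟩

theorem IsC2Holder.bilin (B : F →L[ℝ] G →L[ℝ] H) {f : E → F} {g : E → G}
    (hf : IsC2Holder α s f) (hg : IsC2Holder α s g) :
    IsC2Holder α s (fun x => B (f x) (g x)) := by
  obtain ⟨f₁, f₂, C, hC, hf⟩ := hf
  obtain ⟨g₁, g₂, D, hD, hg⟩ := hg
  have h₁ := HasC1Holder.bilin B hC hD hf.fst hg.fst
  have h₂ := (HasC1Holder.bilin (B.precompR E) hC hD hf.fst hg.snd).add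
    (HasC1Holder.bilin (B.precompL E) hC hD hf.snd hg.fst)
  exact ⟨_, _, _, le_max_of_le_left (by positivity),
    h₁.mono (le_max_left _ _), h₂.mono (le_max_right _ _)⟩

theorem IsC2Holder.smul {f : E → ℝ} {g : E → F} (hf : IsC2Holder α s f)
    (hg : IsC2Holder α s g) : IsC2Holder α s (fun x => f x • g x) :=
  IsC2Holder.bilin (ContinuousLinearMap.lsmul ℝ ℝ) hf hg

theorem IsC2Holder.sum {ι : Type*} (S : Finset ι) {f : ι → E → F}
    (h : ∀ i, IsC2Holder α s (f i)) : IsC2Holder α s (fun x => ∑ i ∈ S, f i x) := by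
  classical
  induction S using Finset.induction_on with
  | empty =>
    refine ⟨fun _ => 0, fun _ => 0, 0, le_rfl, ⟨?_, ⟨?_, ?_⟩, ⟨?_, ?_⟩⟩, ⟨?_, ⟨?_, ?_⟩, ⟨?_, ?_⟩⟩⟩ <;>
      simp [hasFDerivWithinAt_const]
  | insert i S hi ih =>
    simp only [Finset.sum_insert hi]
    exact (h i).add ih

theorem norm_sub_le_mul_rpow (hα : 0 ≤ α) (hα1 : α ≤ 1) {D : ℝ} (hD1 : 1 ≤ D)
    (hD : ∀ x ∈ s, ∀ y ∈ s, ‖x - y‖ ≤ D) : ∀ x ∈ s, ∀ y ∈ s, ‖x - y‖ ≤ D * ‖x - y‖ ^ α := by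
  intro x hx y hy
  rcases (norm_nonneg (x - y)).eq_or_lt with h | h
  · rw [← h]
    positivity
  · calc ‖x - y‖ = ‖x - y‖ ^ (1 - α) * ‖x - y‖ ^ α := by
          rw [← Real.rpow_add h]; simp
      _ ≤ D ^ (1 - α) * ‖x - y‖ ^ α := by
        gcongr
        exact hD x hx y hy
      _ ≤ D * ‖x - y‖ ^ α := by
        gcongr
        simpa using Real.rpow_le_rpow_of_exponent_le hD1 (show 1 - α ≤ 1 by linarith)

theorem BddHolder.of_hasFDerivWithinAt (hα : 0 ≤ α) (hα1 : α ≤ 1) (hs : Convex ℝ s) {D : ℝ} (hD1 : 1 ≤ D)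
    (hD : ∀ x ∈ s, ∀ y ∈ s, ‖x - y‖ ≤ D) {f : E → F} {f' : E → E →L[ℝ] F} {C : ℝ} (hC : 0 ≤ C)
    (hf : ∀ x ∈ s, HasFDerivWithinAt f (f' x) s x) (h0 : ∀ x ∈ s, ‖f x‖ ≤ C)
    (h1 : ∀ x ∈ s, ‖f' x‖ ≤ C) : BddHolder α s f (D * C) := by
  refine ⟨fun x hx => (h0 x hx).trans (by nlinarith), fun x hx y hy => ?_⟩
  calc ‖f x - f y‖ ≤ C * ‖x - y‖ :=
        hs.norm_image_sub_le_of_norm_hasFDerivWithin_le hf h1 hy hx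
    _ ≤ C * (D * ‖x - y‖ ^ α) := by
      gcongr
      exact norm_sub_le_mul_rpow hα hα1 hD1 hD x hx y hy
    _ = _ := by ring

theorem exists_diam_bound (hs : IsCompact s) : ∃ D : ℝ, 1 ≤ D ∧ ∀ x ∈ s, ∀ y ∈ s, ‖x - y‖ ≤ D := by
  obtain ⟨D, hD⟩ := Metric.isBounded_iff.1 hs.isBounded
  exact ⟨max 1 D, le_max_left _ _, fun x hx y hy =>
    (dist_eq_norm x y ▸ hD hx hy).trans (le_max_right _ _)⟩

theorem BddHolder.exists_of_contDiffOn (hα : 0 ≤ α) (hα1 : α ≤ 1) (hc : IsCompact s) (hs : Convex ℝ s)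
    (hu : UniqueDiffOn ℝ s) {f : E → F} (hf : ContDiffOn ℝ 1 f s) :
    ∃ C, 0 ≤ C ∧ BddHolder α s f C := by
  obtain ⟨D, hD1, hD⟩ := exists_diam_bound hc
  obtain ⟨C₀, h0⟩ := hc.exists_bound_of_continuousOn hf.continuousOn
  obtain ⟨C₁, h1⟩ := hc.exists_bound_of_continuousOn (hf.continuousOn_fderivWithin hu le_rfl)
  have hC : 0 ≤ max 0 (max C₀ C₁) := le_max_left _ _
  refine ⟨_, by positivity, BddHolder.of_hasFDerivWithinAt hα hα1 hs hD1 hD hC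
    (fun x hx => (hf.differentiableOn one_ne_zero x hx).hasFDerivWithinAt)
    (fun x hx => (h0 x hx).trans (by simp)) (fun x hx => (h1 x hx).trans (by simp))⟩

theorem IsC2Holder.of_contDiffOn (hα : 0 ≤ α) (hα1 : α ≤ 1) (hc : IsCompact s) (hs : Convex ℝ s)
    (hu : UniqueDiffOn ℝ s) {f : E → F} (hf : ContDiffOn ℝ 3 f s) : IsC2Holder α s f := by
  have hf1 : ContDiffOn ℝ 2 (fderivWithin ℝ f s) s := hf.fderivWithin hu (by norm_num)
  have hf2 : ContDiffOn ℝ 1 (fderivWithin ℝ (fderivWithin ℝ f s) s) s :=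
    hf1.fderivWithin hu (by norm_num)
  obtain ⟨C₀, h0, H0⟩ := BddHolder.exists_of_contDiffOn hα hα1 hc hs hu (hf.of_le (by norm_num))
  obtain ⟨C₁, h1, H1⟩ := BddHolder.exists_of_contDiffOn hα hα1 hc hs hu (hf1.of_le (by norm_num))
  obtain ⟨C₂, h2, H2⟩ := BddHolder.exists_of_contDiffOn hα hα1 hc hs hu hf2
  refine ⟨_, _, C₀ + C₁ + C₂, by positivity, ⟨fun x hx =>
    (hf.differentiableOn (by norm_num) x hx).hasFDerivWithinAt, H0.mono (by linarith),
    H1.mono (by linarith)⟩, ⟨fun x hx =>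
    (hf1.differentiableOn (by norm_num) x hx).hasFDerivWithinAt, H1.mono (by linarith),
    H2.mono (by linarith)⟩⟩

theorem HasC2Holder.symm (hs : Convex ℝ s) (hne : (interior s).Nonempty) {f : E → F}
    {f₁ : E → E →L[ℝ] F} {f₂ : E → E →L[ℝ] E →L[ℝ] F} {C : ℝ} (h : HasC2Holder α s f f₁ f₂ C)
    {x : E} (hx : x ∈ s) (v w : E) : f₂ x v w = f₂ x w v :=
  hs.second_derivative_within_at_symmetric hne
    (fun y hy => (h.fst.hasFDeriv y (interior_subset hy)).hasFDerivAt
      (mem_interior_iff_mem_nhds.1 hy)) hx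
    ((h.snd.hasFDeriv x hx).mono interior_subset) v w

theorem norm_iteratedFDerivWithin_two_sub {f : E → F} (hu : UniqueDiffOn ℝ s)
    {x y : E} (hx : x ∈ s) (hy : y ∈ s) :
    ‖iteratedFDerivWithin ℝ 2 f s x - iteratedFDerivWithin ℝ 2 f s y‖ =
      ‖fderivWithin ℝ (fderivWithin ℝ f s) s x - fderivWithin ℝ (fderivWithin ℝ f s) s y‖ := by
  refine le_antisymm ?_ ?_
  · refine ContinuousMultilinearMap.opNorm_le_bound (norm_nonneg _) fun m => ?_
    rw [sub_apply, iteratedFDerivWithin_two_apply f hu hx, iteratedFDerivWithin_two_apply f hu hy]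
    simpa [Fin.prod_univ_two, mul_assoc] using (fderivWithin ℝ (fderivWithin ℝ f s) s x -
      fderivWithin ℝ (fderivWithin ℝ f s) s y).le_opNorm₂ (m 0) (m 1)
  · refine ContinuousLinearMap.opNorm_le_bound₂ _ (norm_nonneg _) fun v w => ?_
    have := (iteratedFDerivWithin ℝ 2 f s x - iteratedFDerivWithin ℝ 2 f s y).le_opNorm ![v, w]
    rw [sub_apply, iteratedFDerivWithin_two_apply f hu hx,
      iteratedFDerivWithin_two_apply f hu hy] at this
    simpa [Fin.prod_univ_two, mul_assoc] using this

theorem norm_iteratedFDerivWithin_two {f : E → F} (hu : UniqueDiffOn ℝ s) {x : E} (hx : x ∈ s) :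
    ‖iteratedFDerivWithin ℝ 2 f s x‖ = ‖fderivWithin ℝ (fderivWithin ℝ f s) s x‖ := by
  rw [← norm_iteratedFDerivWithin_fderivWithin hu hx, norm_iteratedFDerivWithin_one _ (hu x hx)]

end Calculus

section Gluing

variable {E F : Type*} [NormedAddCommGroup E] [NormedSpace ℝ E]
  [NormedAddCommGroup F] [NormedSpace ℝ F] {α : ℝ} {s t : Set E}

open scoped Classical in
theorem BddHolder.glue {f g : E → F} {C : ℝ}
    (hst : ∀ x ∈ s, ∀ y ∈ t, ∃ z ∈ s ∩ t, ‖x - z‖ ≤ ‖x - y‖ ∧ ‖z - y‖ ≤ ‖x - y‖) (hα : 0 ≤ α)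
    (hC : 0 ≤ C) (hf : BddHolder α s f C) (hg : BddHolder α t g C) (hfg : EqOn f g (s ∩ t)) :
    BddHolder α (s ∪ t) (s.piecewise f g) (2 * C) := by
  have hs : ∀ x ∈ s, s.piecewise f g x = f x := fun x hx => piecewise_eq_of_mem _ _ _ hx
  have ht : ∀ x ∈ t, s.piecewise f g x = g x := fun x hx => by
    by_cases hxs : x ∈ s
    · rw [hs x hxs, hfg ⟨hxs, hx⟩]
    · exact piecewise_eq_of_notMem _ _ _ hxs
  have key : ∀ x ∈ s, ∀ y ∈ t, ‖f x - g y‖ ≤ 2 * C * ‖x - y‖ ^ α := by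
    intro x hx y hy
    obtain ⟨z, hz, hxz, hzy⟩ := hst x hx y hy
    calc ‖f x - g y‖ = ‖(f x - f z) + (g z - g y)‖ := by rw [hfg hz]; simp
      _ ≤ C * ‖x - z‖ ^ α + C * ‖z - y‖ ^ α :=
        norm_add_le_of_le (hf.holder x hx z hz.1) (hg.holder z hz.2 y hy)
      _ ≤ C * ‖x - y‖ ^ α + C * ‖x - y‖ ^ α := by gcongr
      _ = _ := by ring
  refine ⟨?_, ?_⟩
  · rintro x (hx | hx)
    · rw [hs x hx]
      exact (hf.bound x hx).trans (by linarith)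
    · rw [ht x hx]
      exact (hg.bound x hx).trans (by linarith)
  · have h2 : ∀ r : ℝ, 0 ≤ r → C * r ^ α ≤ 2 * C * r ^ α := fun r hr => by gcongr; linarith
    rintro x (hx | hx) y (hy | hy)
    · rw [hs x hx, hs y hy]
      exact (hf.holder x hx y hy).trans (h2 _ (norm_nonneg _))
    · rw [hs x hx, ht y hy]
      exact key x hx y hy
    · rw [ht x hx, hs y hy, norm_sub_rev, norm_sub_rev x y]
      exact key y hy x hx
    · rw [ht x hx, ht y hy]
      exact (hg.holder x hx y hy).trans (h2 _ (norm_nonneg _))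

open scoped Classical in
theorem HasC1Holder.glue {f g : E → F} {f' g' : E → E →L[ℝ] F} {C : ℝ}
    (hst : ∀ x ∈ s, ∀ y ∈ t, ∃ z ∈ s ∩ t, ‖x - z‖ ≤ ‖x - y‖ ∧ ‖z - y‖ ≤ ‖x - y‖)
    (hsc : IsClosed s) (htc : IsClosed t) (hα : 0 ≤ α)
    (hC : 0 ≤ C) (hf : HasC1Holder α s f f' C) (hg : HasC1Holder α t g g' C)
    (hfg : EqOn f g (s ∩ t)) (hfg' : EqOn f' g' (s ∩ t)) :
    HasC1Holder α (s ∪ t) (s.piecewise f g) (s.piecewise f' g') (2 * C) := by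
  refine ⟨fun x hx => ?_, hf.base.glue hst hα hC hg.base hfg,
    hf.deriv.glue hst hα hC hg.deriv hfg'⟩
  have hs : EqOn (s.piecewise f g) f s := piecewise_eqOn _ _ _
  have ht : EqOn (s.piecewise f g) g t := fun x hx => by
    by_cases hxs : x ∈ s
    · rw [hs hxs, hfg ⟨hxs, hx⟩]
    · exact piecewise_eq_of_notMem _ _ _ hxs
  refine HasFDerivWithinAt.union ?_ ?_
  · by_cases hxs : x ∈ s
    · rw [piecewise_eq_of_mem _ _ _ hxs]
      exact (hf.hasFDeriv x hxs).congr hs (hs hxs)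
    · exact .of_notMem_closure (by rwa [hsc.closure_eq])
  · by_cases hxt : x ∈ t
    · have : s.piecewise f' g' x = g' x := by
        by_cases hxs : x ∈ s
        · rw [piecewise_eq_of_mem _ _ _ hxs, hfg' ⟨hxs, hxt⟩]
        · exact piecewise_eq_of_notMem _ _ _ hxs
      rw [this]
      exact (hg.hasFDeriv x hxt).congr ht (ht hxt)
    · exact .of_notMem_closure (by rwa [htc.closure_eq])

/-- The bounds making up a `C^{2,α}`-norm bound by `M`. -/
def C2HolderBound (α : ℝ≥0) (s : Set E) (u : E → F) (M : ℝ≥0) : Prop :=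
  (∀ i : ℕ, i ≤ 2 → ∀ x ∈ s, ‖iteratedFDerivWithin ℝ i u s x‖ ≤ (M : ℝ)) ∧
    HolderOnWith M α (iteratedFDerivWithin ℝ 2 u s) s

theorem HasC2Holder.of_c2HolderBound {α : ℝ≥0} (hα1 : α ≤ 1) (hs : Convex ℝ s)
    (hu : UniqueDiffOn ℝ s) {D : ℝ} (hD1 : 1 ≤ D) (hD : ∀ x ∈ s, ∀ y ∈ s, ‖x - y‖ ≤ D)
    {u : E → F} {M : ℝ≥0} (h : ContDiffOn ℝ 2 u s) (hM : C2HolderBound α s u M) :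
    HasC2Holder α s u (fderivWithin ℝ u s) (fderivWithin ℝ (fderivWithin ℝ u s) s) (D * M) := by
  have hα1 : (α : ℝ) ≤ 1 := by exact_mod_cast hα1
  have h1 : ContDiffOn ℝ 1 (fderivWithin ℝ u s) s := h.fderivWithin hu (by norm_num)
  have d0 : ∀ x ∈ s, HasFDerivWithinAt u (fderivWithin ℝ u s x) s x := fun x hx =>
    (h.differentiableOn (by norm_num) x hx).hasFDerivWithinAt
  have d1 : ∀ x ∈ s, HasFDerivWithinAt (fderivWithin ℝ u s)
      (fderivWithin ℝ (fderivWithin ℝ u s) s x) s x := fun x hx =>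
    (h1.differentiableOn (by norm_num) x hx).hasFDerivWithinAt
  have b0 : ∀ x ∈ s, ‖u x‖ ≤ M := fun x hx => by
    simpa using hM.1 0 (by norm_num) x hx
  have b1 : ∀ x ∈ s, ‖fderivWithin ℝ u s x‖ ≤ M := fun x hx => by
    simpa [norm_iteratedFDerivWithin_one _ (hu x hx)] using hM.1 1 (by norm_num) x hx
  have b2 : ∀ x ∈ s, ‖fderivWithin ℝ (fderivWithin ℝ u s) s x‖ ≤ M := fun x hx => by
    simpa [norm_iteratedFDerivWithin_two hu hx] using hM.1 2 le_rfl x hx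
  have H0 := BddHolder.of_hasFDerivWithinAt α.2 hα1 hs hD1 hD M.2 d0 b0 b1
  have H1 := BddHolder.of_hasFDerivWithinAt α.2 hα1 hs hD1 hD M.2 d1 b1 b2
  have H2 : BddHolder α s (fderivWithin ℝ (fderivWithin ℝ u s) s) M := by
    refine ⟨b2, fun x hx y hy => ?_⟩
    rw [← norm_iteratedFDerivWithin_two_sub hu hx hy, ← dist_eq_norm, ← dist_eq_norm]
    exact hM.2.dist_le hx hy
  exact ⟨⟨d0, H0, H1⟩, ⟨d1, H1, H2.mono (le_mul_of_one_le_left M.2 hD1)⟩⟩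

theorem exists_c2HolderBound {α : ℝ≥0} (hc : IsCompact s) (hu : UniqueDiffOn ℝ s)
    {u : E → F} (h : ContDiffOn ℝ 2 u s)
    (hα : ∃ C : ℝ≥0, HolderOnWith C α (iteratedFDerivWithin ℝ 2 u s) s) :
    ∃ M, C2HolderBound α s u M := by
  obtain ⟨C, hC⟩ := hα
  have (i : ℕ) (hi : i ≤ 2) : ∃ M : ℝ, ∀ x ∈ s, ‖iteratedFDerivWithin ℝ i u s x‖ ≤ M :=
    hc.exists_bound_of_continuousOn (h.continuousOn_iteratedFDerivWithin (by exact_mod_cast hi) hu)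
  choose! B hB using this
  set M : ℝ := max C (max (B 0) (max (B 1) (B 2)))
  have hM : 0 ≤ M := le_max_of_le_left C.2
  refine ⟨⟨M, hM⟩, fun i hi x hx => (hB i hi x hx).trans ?_, fun x hx y hy => ?_⟩
  · change B i ≤ M
    interval_cases i <;> simp [M]
  · refine (hC x hx y hy).trans ?_
    gcongr
    exact ENNReal.coe_le_coe.2 (NNReal.coe_le_coe.1 (le_max_left _ _ : (C : ℝ) ≤ M))

theorem HasC2Holder.contDiffOn (hα : 0 < α) (hu : UniqueDiffOn ℝ s) {u : E → F}
    {u₁ : E → E →L[ℝ] F} {u₂ : E → E →L[ℝ] E →L[ℝ] F} {C : ℝ}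
    (h : HasC2Holder α s u u₁ u₂ C) : ContDiffOn ℝ 2 u s := by
  have hcont : ContinuousOn u₂ s := by
    intro x hx
    rw [ContinuousWithinAt, tendsto_iff_norm_sub_tendsto_zero]
    have ht : Filter.Tendsto (fun y => C * ‖y - x‖ ^ α) (𝓝[s] x) (𝓝 0) := by
      have : ContinuousAt (fun y => C * ‖y - x‖ ^ α) x := by
        refine continuousAt_const.mul (ContinuousAt.rpow_const (by fun_prop) (Or.inr hα.le))
      have h2 := this.tendsto.mono_left (nhdsWithin_le_nhds (s := s))
      simpa [Real.zero_rpow hα.ne'] using h2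
    refine squeeze_zero' (Filter.Eventually.of_forall fun _ => norm_nonneg _) ?_ ht
    filter_upwards [self_mem_nhdsWithin] with y hy using h.snd.deriv.holder y hy x hx
  have h1 : ContDiffOn ℝ (0 + 1) u₁ s :=
    (contDiffOn_succ_iff_hasFDerivWithinAt_of_uniqueDiffOn hu).2
      ⟨by simp, u₂, contDiffOn_zero.2 hcont, h.snd.hasFDeriv⟩
  have h2 : ContDiffOn ℝ (1 + 1) u s :=
    (contDiffOn_succ_iff_hasFDerivWithinAt_of_uniqueDiffOn hu).2
      ⟨by simp, u₁, by simpa using h1, h.fst.hasFDeriv⟩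
  exact h2.of_le (by norm_num)

theorem HasC2Holder.c2HolderBound {α : ℝ≥0} (hu : UniqueDiffOn ℝ s) {u : E → F}
    {u₁ : E → E →L[ℝ] F} {u₂ : E → E →L[ℝ] E →L[ℝ] F} {C : ℝ≥0}
    (h : HasC2Holder α s u u₁ u₂ C) : C2HolderBound α s u C := by
  have e1 : ∀ x ∈ s, fderivWithin ℝ u s x = u₁ x := fun x hx =>
    (h.fst.hasFDeriv x hx).fderivWithin (hu x hx)
  have e2 : ∀ x ∈ s, fderivWithin ℝ (fderivWithin ℝ u s) s x = u₂ x := fun x hx =>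
    ((h.snd.hasFDeriv x hx).congr e1 (e1 x hx)).fderivWithin (hu x hx)
  refine ⟨fun i hi x hx => ?_, fun x hx y hy => ?_⟩
  · interval_cases i
    · simpa using h.fst.base.bound x hx
    · rw [norm_iteratedFDerivWithin_one _ (hu x hx), e1 x hx]
      exact h.fst.deriv.bound x hx
    · rw [norm_iteratedFDerivWithin_two hu hx, e2 x hx]
      exact h.snd.deriv.bound x hx
  · have key : dist (iteratedFDerivWithin ℝ 2 u s x) (iteratedFDerivWithin ℝ 2 u s y) ≤
        C * dist x y ^ (α : ℝ) := by
      rw [dist_eq_norm, dist_eq_norm, norm_iteratedFDerivWithin_two_sub hu hx hy, e2 x hx, e2 y hy]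
      exact h.snd.deriv.holder x hx y hy
    rw [edist_nndist, edist_nndist, ← ENNReal.coe_rpow_of_nonneg _ α.coe_nonneg, ← ENNReal.coe_mul,
      ENNReal.coe_le_coe]
    exact_mod_cast key

theorem HasFDerivWithinAt.comp_proj_eq {A B Q : Set E} {P : E →L[ℝ] E} {f g : E → F}
    {f' g' : E →L[ℝ] F} {x : E} (hQ : UniqueDiffWithinAt ℝ Q x) (hxQ : x ∈ Q)
    (hPA : MapsTo P Q A) (hPB : MapsTo P Q B)
    (hf : HasFDerivWithinAt f f' A (P x)) (hg : HasFDerivWithinAt g g' B (P x))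
    (hfg : ∀ y ∈ Q, f (P y) = g (P y)) : f'.comp P = g'.comp P := by
  have h1 := hf.comp x P.hasFDerivWithinAt hPA
  have h2 := hg.comp x P.hasFDerivWithinAt hPB
  exact hQ.eq h1 (h2.congr hfg (hfg x hxQ))

theorem HasC2Holder.hasDerivWithinAt_curve {u : E → F} {u₁ : E → E →L[ℝ] F}
    {u₂ : E → E →L[ℝ] E →L[ℝ] F} {C : ℝ} (h : HasC2Holder α s u u₁ u₂ C) {I : Set ℝ}
    {c c' : ℝ → E} (hc : ∀ r ∈ I, HasDerivWithinAt c (c' r) I r) (hcs : MapsTo c I s) {r : ℝ}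
    (hr : r ∈ I) : HasDerivWithinAt (fun r => u (c r)) (u₁ (c r) (c' r)) I r :=
  (h.fst.hasFDeriv _ (hcs hr)).comp_hasDerivWithinAt r (hc r hr) hcs

theorem HasC2Holder.hasDerivWithinAt_curve_deriv {u : E → F} {u₁ : E → E →L[ℝ] F}
    {u₂ : E → E →L[ℝ] E →L[ℝ] F} {C : ℝ} (h : HasC2Holder α s u u₁ u₂ C) {I : Set ℝ}
    {c c' : ℝ → E} {c'' : E} (hc : ∀ r ∈ I, HasDerivWithinAt c (c' r) I r) (hcs : MapsTo c I s)
    {r : ℝ} (hr : r ∈ I) (hc' : HasDerivWithinAt c' c'' I r) :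
    HasDerivWithinAt (fun r => u₁ (c r) (c' r)) (u₂ (c r) (c' r) (c' r) + u₁ (c r) c'') I r :=
  ((h.snd.hasFDeriv _ (hcs hr)).comp_hasDerivWithinAt r (hc r hr) hcs).clm_apply hc'

end Gluing

section Cube

variable {n : ℕ} {R : ℝ}

local notation "𝔼" n => EuclideanSpace ℝ (Fin (n + 1))

/-- The closed cube `[-R, R]^{n+1}`. -/
def cube (n : ℕ) (R : ℝ) : Set (𝔼 n) := {x | ∀ i, |x i| ≤ R}

/-- The upper half of the cube. -/
def upperCube (n : ℕ) (R : ℝ) : Set (𝔼 n) := {x ∈ cube n R | 0 ≤ x (Fin.last n)}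

/-- The lower half of the cube. -/
def lowerCube (n : ℕ) (R : ℝ) : Set (𝔼 n) := {x ∈ cube n R | x (Fin.last n) ≤ 0}

/-- The unit normal of the flat boundary. -/
def normalVec (n : ℕ) : 𝔼 n := EuclideanSpace.single (Fin.last n) 1

/-- The orthogonal projection onto the hyperplane `x_n = 0`. -/
def tangProj (n : ℕ) : (𝔼 n) →L[ℝ] (𝔼 n) :=
  ContinuousLinearMap.id ℝ _ -
    (EuclideanSpace.proj (𝕜 := ℝ) (Fin.last n)).smulRight (normalVec n)

theorem tangProj_apply (x : 𝔼 n) : tangProj n x = x - x (Fin.last n) • normalVec n := rfl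

@[simp] theorem normalVec_last : normalVec n (Fin.last n) = 1 := by simp [normalVec]

@[simp] theorem normalVec_castSucc (i : Fin n) : normalVec n i.castSucc = 0 := by
  simp [normalVec, Fin.castSucc_ne_last]

@[simp] theorem tangProj_last (x : 𝔼 n) : tangProj n x (Fin.last n) = 0 := by
  simp [tangProj_apply]

@[simp] theorem tangProj_castSucc (x : 𝔼 n) (i : Fin n) :
    tangProj n x i.castSucc = x i.castSucc := by
  simp [tangProj_apply]

theorem tangProj_eq_self {x : 𝔼 n} (hx : x (Fin.last n) = 0) : tangProj n x = x := by
  simp [tangProj_apply, hx]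

theorem tangProj_add_normal (x : 𝔼 n) : tangProj n x + x (Fin.last n) • normalVec n = x := by
  simp [tangProj_apply]

theorem tangProj_mem_cube (hR : 0 ≤ R) {x : 𝔼 n} (hx : x ∈ cube n R) : tangProj n x ∈ cube n R := by
  intro i
  induction i using Fin.lastCases with
  | last => simpa using hR
  | cast i => simpa using hx i.castSucc

theorem tangProj_mem_upperCube (hR : 0 ≤ R) {x : 𝔼 n} (hx : x ∈ cube n R) :
    tangProj n x ∈ upperCube n R := ⟨tangProj_mem_cube hR hx, by simp⟩

theorem tangProj_mem_lowerCube (hR : 0 ≤ R) {x : 𝔼 n} (hx : x ∈ cube n R) :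
    tangProj n x ∈ lowerCube n R := ⟨tangProj_mem_cube hR hx, by simp⟩

/-- A coordinate box in Euclidean space. -/
def coordBox (l r : Fin (n + 1) → ℝ) : Set (𝔼 n) := {x | ∀ i, x i ∈ Icc (l i) (r i)}

theorem convex_coordBox (l r : Fin (n + 1) → ℝ) : Convex ℝ (coordBox l r) := by
  intro x hx y hy a b ha hb hab i
  exact (convex_Icc (l i) (r i)) (hx i) (hy i) ha hb hab

theorem isCompact_coordBox (l r : Fin (n + 1) → ℝ) : IsCompact (coordBox l r) := by
  have h := (EuclideanSpace.equiv (Fin (n + 1)) ℝ).toHomeomorph.isCompact_preimage.2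
    (isCompact_Icc (a := l) (b := r))
  convert h using 1
  ext x
  simp [coordBox, Pi.le_def, forall_and]

theorem interior_coordBox_nonempty {l r : Fin (n + 1) → ℝ} (h : ∀ i, l i < r i) :
    (interior (coordBox l r)).Nonempty := by
  have ho : IsOpen {x : 𝔼 n | ∀ i, x i ∈ Ioo (l i) (r i)} := by
    simp only [ofPred_forall]
    exact isOpen_iInter_of_finite fun i =>
      isOpen_Ioo.preimage (EuclideanSpace.proj (𝕜 := ℝ) i).continuous
  have hsub : {x : 𝔼 n | ∀ i, x i ∈ Ioo (l i) (r i)} ⊆ coordBox l r :=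
    fun x hx i => Ioo_subset_Icc_self (hx i)
  refine ⟨WithLp.toLp 2 fun i => (l i + r i) / 2, interior_maximal hsub ho fun i => ?_⟩
  have := h i
  constructor <;> simp <;> linarith

theorem cube_eq_coordBox : cube n R = coordBox (fun _ => -R) (fun _ => R) := by
  ext x
  simp [cube, coordBox, abs_le]

theorem upperCube_eq_coordBox (hR : 0 < R) : upperCube n R =
    coordBox (fun i => if i = Fin.last n then 0 else -R) (fun _ => R) := by
  ext x
  constructor
  · rintro ⟨h, h0⟩ i
    have := abs_le.1 (h i)
    dsimp only
    split_ifs with hi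
    · subst hi
      exact ⟨h0, this.2⟩
    · exact this
  · intro h
    have hl := h (Fin.last n)
    simp only [if_true] at hl
    refine ⟨fun i => abs_le.2 ?_, hl.1⟩
    have := h i
    dsimp only at this
    split_ifs at this with hi
    · exact ⟨by linarith [this.1], this.2⟩
    · exact this

theorem lowerCube_eq_coordBox (hR : 0 < R) : lowerCube n R =
    coordBox (fun _ => -R) (fun i => if i = Fin.last n then 0 else R) := by
  ext x
  constructor
  · rintro ⟨h, h0⟩ i
    have := abs_le.1 (h i)
    dsimp only
    split_ifs with hi
    · subst hi
      exact ⟨this.1, h0⟩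
    · exact this
  · intro h
    have hl := h (Fin.last n)
    simp only [if_true] at hl
    refine ⟨fun i => abs_le.2 ?_, hl.2⟩
    have := h i
    dsimp only at this
    split_ifs at this with hi
    · exact ⟨this.1, by linarith [this.2]⟩
    · exact this

theorem cube_eq_union : cube n R = upperCube n R ∪ lowerCube n R := by
  ext x
  constructor
  · intro hx
    rcases le_total 0 (x (Fin.last n)) with h | h
    exacts [Or.inl ⟨hx, h⟩, Or.inr ⟨hx, h⟩]
  · rintro (h | h) <;> exact h.1

theorem convex_cube : Convex ℝ (cube n R) := cube_eq_coordBox ▸ convex_coordBox _ _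

theorem uniqueDiffOn_cube (hR : 0 < R) : UniqueDiffOn ℝ (cube n R) :=
  uniqueDiffOn_convex convex_cube <|
    cube_eq_coordBox ▸ interior_coordBox_nonempty fun _ => by linarith

theorem convex_upperCube (hR : 0 < R) : Convex ℝ (upperCube n R) :=
  upperCube_eq_coordBox hR ▸ convex_coordBox _ _

theorem isCompact_upperCube (hR : 0 < R) : IsCompact (upperCube n R) :=
  upperCube_eq_coordBox hR ▸ isCompact_coordBox _ _

theorem interior_upperCube_nonempty (hR : 0 < R) : (interior (upperCube n R)).Nonempty :=
  upperCube_eq_coordBox hR ▸ interior_coordBox_nonempty fun i => by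
    split_ifs <;> linarith

theorem uniqueDiffOn_upperCube (hR : 0 < R) : UniqueDiffOn ℝ (upperCube n R) :=
  uniqueDiffOn_convex (convex_upperCube hR) (interior_upperCube_nonempty hR)

theorem convex_lowerCube (hR : 0 < R) : Convex ℝ (lowerCube n R) :=
  lowerCube_eq_coordBox hR ▸ convex_coordBox _ _

theorem isCompact_lowerCube (hR : 0 < R) : IsCompact (lowerCube n R) :=
  lowerCube_eq_coordBox hR ▸ isCompact_coordBox _ _

theorem interior_lowerCube_nonempty (hR : 0 < R) : (interior (lowerCube n R)).Nonempty :=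
  lowerCube_eq_coordBox hR ▸ interior_coordBox_nonempty fun i => by
    split_ifs <;> linarith

theorem uniqueDiffOn_lowerCube (hR : 0 < R) : UniqueDiffOn ℝ (lowerCube n R) :=
  uniqueDiffOn_convex (convex_lowerCube hR) (interior_lowerCube_nonempty hR)

/-- A segment from the upper to the lower half of the cube crosses the flat boundary. -/
theorem exists_mem_interface {x y : 𝔼 n} (hx : x ∈ upperCube n R) (hy : y ∈ lowerCube n R) :
    ∃ z ∈ upperCube n R ∩ lowerCube n R, ‖x - z‖ ≤ ‖x - y‖ ∧ ‖z - y‖ ≤ ‖x - y‖ := by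
  rcases hx.2.eq_or_lt with h0 | h0
  · exact ⟨x, ⟨hx, hx.1, h0.ge⟩, by simp, le_rfl⟩
  have hd : 0 < x (Fin.last n) - y (Fin.last n) := by linarith [hy.2]
  set σ := x (Fin.last n) / (x (Fin.last n) - y (Fin.last n))
  have hσ0 : 0 ≤ σ := by positivity
  have hσ1 : σ ≤ 1 := (div_le_one hd).2 (by linarith [hy.2])
  set z := (1 - σ) • x + σ • y
  have hz : z ∈ cube n R := convex_cube hx.1 hy.1 (by linarith) hσ0 (by ring)
  have hz0 : z (Fin.last n) = 0 := by
    simp only [z, σ, PiLp.add_apply, PiLp.smul_apply, smul_eq_mul]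
    field_simp
    ring
  refine ⟨z, ⟨⟨hz, hz0.ge⟩, hz, hz0.le⟩, ?_, ?_⟩
  · have : x - z = σ • (x - y) := by simp only [z]; module
    rw [this, norm_smul, Real.norm_of_nonneg hσ0]
    exact mul_le_of_le_one_left (norm_nonneg _) hσ1
  · have : z - y = (1 - σ) • (x - y) := by simp only [z]; module
    rw [this, norm_smul, Real.norm_of_nonneg (by linarith)]
    exact mul_le_of_le_one_left (norm_nonneg _) (by linarith)

/-- A bounded profile agreeing with `t` to second order at `t = 0`. -/
def profile (δ t : ℝ) : ℝ := δ ^ 2 * t / (δ ^ 2 + t ^ 2)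

/-- The derivative of `profile`. -/
def profileDeriv (δ t : ℝ) : ℝ := δ ^ 2 * (δ ^ 2 - t ^ 2) / (δ ^ 2 + t ^ 2) ^ 2

@[simp] theorem profile_zero (δ : ℝ) : profile δ 0 = 0 := by simp [profile]

theorem profileDeriv_zero {δ : ℝ} (hδ : 0 < δ) : profileDeriv δ 0 = 1 := by
  simp [profileDeriv]
  field_simp

theorem profile_nonneg {δ t : ℝ} (ht : 0 ≤ t) : 0 ≤ profile δ t := by
  unfold profile
  positivity

theorem profile_le {δ t : ℝ} (hδ : 0 < δ) : profile δ t ≤ δ := by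
  unfold profile
  rw [div_le_iff₀ (by positivity)]
  nlinarith [mul_nonneg hδ.le (sq_nonneg (δ - t)), mul_nonneg hδ.le (sq_nonneg δ),
    mul_nonneg hδ.le (sq_nonneg t)]

theorem hasDerivAt_profile {δ : ℝ} (hδ : 0 < δ) (t : ℝ) :
    HasDerivAt (profile δ) (profileDeriv δ t) t := by
  have h1 : HasDerivAt (fun t : ℝ => δ ^ 2 * t) (δ ^ 2) t := by
    simpa using (hasDerivAt_id t).const_mul (δ ^ 2)
  have h2 : HasDerivAt (fun t : ℝ => δ ^ 2 + t ^ 2) (2 * t) t := by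
    simpa using (hasDerivAt_pow 2 t).const_add (δ ^ 2)
  refine (h1.div h2 (by positivity)).congr_deriv ?_
  unfold profileDeriv
  congr 1
  ring

theorem hasDerivAt_profileDeriv {δ : ℝ} (hδ : 0 < δ) : HasDerivAt (profileDeriv δ) 0 0 := by
  have h1 : HasDerivAt (fun t : ℝ => δ ^ 2 * (δ ^ 2 - t ^ 2)) 0 0 := by
    simpa using ((hasDerivAt_pow 2 (0 : ℝ)).const_sub (δ ^ 2)).const_mul (δ ^ 2)
  have h2 : HasDerivAt (fun t : ℝ => (δ ^ 2 + t ^ 2) ^ 2) 0 0 := by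
    simpa using ((hasDerivAt_pow 2 (0 : ℝ)).const_add (δ ^ 2)).fun_pow 2
  exact (h1.div h2 (by positivity)).congr_deriv (by simp)

/-- A second-order perturbation of the reflection at the hyperplane `x_n = 0`. -/
def reflMap (δ k : ℝ) (V : (𝔼 n) → 𝔼 n) (B : (𝔼 n) → ℝ) (x : 𝔼 n) : 𝔼 n :=
  tangProj n x + profile δ (-x (Fin.last n)) • V (tangProj n x) +
    (k * profile δ (-x (Fin.last n)) + B (tangProj n x) * profile δ (-x (Fin.last n)) ^ 2) •
      normalVec n

theorem reflMap_sub_smul_normal {δ k : ℝ} {V : (𝔼 n) → 𝔼 n} {B : (𝔼 n) → ℝ} {x : 𝔼 n}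
    (hx : x (Fin.last n) = 0) (t : ℝ) : reflMap δ k V B (x - t • normalVec n) =
      x + profile δ t • V x + (k * profile δ t + B x * profile δ t ^ 2) • normalVec n := by
  have h1 : tangProj n (x - t • normalVec n) = x := by
    rw [tangProj_apply]
    simp [hx]
  have h2 : -(x - t • normalVec n) (Fin.last n) = t := by simp [hx]
  rw [reflMap, h1, h2]

theorem reflMap_eq_self {δ k : ℝ} {V : (𝔼 n) → 𝔼 n} {B : (𝔼 n) → ℝ} {x : 𝔼 n}
    (hx : x (Fin.last n) = 0) : reflMap δ k V B x = x := by
  simpa using reflMap_sub_smul_normal (δ := δ) (k := k) (V := V) (B := B) hx 0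

theorem isC2Holder_reflMap {α : ℝ} (hα : 0 ≤ α) (hα1 : α ≤ 1) (hR : 0 < R) {δ : ℝ} (hδ : 0 < δ)
    (k : ℝ) {V : (𝔼 n) → 𝔼 n} {B : (𝔼 n) → ℝ} (hV : IsC2Holder α (upperCube n R) V)
    (hB : IsC2Holder α (upperCube n R) B) :
    IsC2Holder α (lowerCube n R) (reflMap δ k V B) := by
  have smooth {F : Type} [NormedAddCommGroup F] [NormedSpace ℝ F] {f : (𝔼 n) → F}
      (hf : ContDiff ℝ 3 f) : IsC2Holder α (lowerCube n R) f :=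
    IsC2Holder.of_contDiffOn hα hα1 (isCompact_lowerCube hR) (convex_lowerCube hR)
      (uniqueDiffOn_lowerCube hR) hf.contDiffOn
  have hcoord : ContDiff ℝ 3 (fun x : 𝔼 n => -x (Fin.last n)) :=
    (EuclideanSpace.proj (𝕜 := ℝ) (Fin.last n)).contDiff.neg
  have hprof : ContDiff ℝ 3 (fun x : 𝔼 n => profile δ (-x (Fin.last n))) := by
    unfold profile
    exact (contDiff_const.mul hcoord).div (contDiff_const.add (hcoord.pow 2)) fun x => by positivity
  have hP : IsC2Holder α (lowerCube n R) (tangProj n) := smooth (tangProj n).contDiff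
  have hPm : MapsTo (tangProj n) (lowerCube n R) (upperCube n R) := fun x hx =>
    tangProj_mem_upperCube hR.le hx.1
  have hVP := hV.comp hα (convex_lowerCube hR) hP hPm
  have hBP := hB.comp hα (convex_lowerCube hR) hP hPm
  exact (hP.add ((smooth hprof).smul hVP)).add
    (((smooth (contDiff_const.mul hprof)).add (hBP.smul (smooth (hprof.pow 2)))).smul
      (smooth contDiff_const))

section Jets

variable {α C C' : ℝ} {s : Set (𝔼 n)} {u v : (𝔼 n) → ℝ} {u₁ v₁ : (𝔼 n) → (𝔼 n) →L[ℝ] ℝ}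
  {u₂ v₂ : (𝔼 n) → (𝔼 n) →L[ℝ] (𝔼 n) →L[ℝ] ℝ}

theorem HasC2Holder.apply_tangProj_eq_zero (hR : 0 < R) (hPs : MapsTo (tangProj n) (cube n R) s)
    (h : HasC2Holder α s u u₁ u₂ C) (hu0 : ∀ y ∈ cube n R, y (Fin.last n) = 0 → u y = 0)
    {x : 𝔼 n} (hx : x ∈ cube n R) (hxn : x (Fin.last n) = 0) (p : 𝔼 n) :
    u₁ x (tangProj n p) = 0 := by
  have hPx := tangProj_eq_self hxn
  have key := HasFDerivWithinAt.comp_proj_eq (P := tangProj n) (B := univ) (f := u)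
    (g := fun _ => (0 : ℝ)) (f' := u₁ x) (g' := 0) (uniqueDiffOn_cube hR x hx) hx hPs
    (mapsTo_univ _ _) (by
      have := h.fst.hasFDeriv (tangProj n x) (hPs hx)
      rwa [hPx] at this ⊢) (hasFDerivWithinAt_const _ _ _)
    fun y hy => hu0 _ (tangProj_mem_cube hR.le hy) (tangProj_last y)
  simpa using congrArg (fun T : (𝔼 n) →L[ℝ] ℝ => T p) key

theorem HasC2Holder.apply_tangProj_tangProj_eq_zero (hR : 0 < R)
    (hPs : MapsTo (tangProj n) (cube n R) s) (h : HasC2Holder α s u u₁ u₂ C)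
    (hu0 : ∀ y ∈ cube n R, y (Fin.last n) = 0 → u y = 0)
    {x : 𝔼 n} (hx : x ∈ cube n R) (hxn : x (Fin.last n) = 0) (p q : 𝔼 n) :
    u₂ x (tangProj n p) (tangProj n q) = 0 := by
  have hPx := tangProj_eq_self hxn
  have hd : HasFDerivWithinAt (fun y => u₁ y (tangProj n q))
      ((ContinuousLinearMap.apply ℝ ℝ (tangProj n q)).comp (u₂ x)) s (tangProj n x) := by
    have := h.snd.hasFDeriv (tangProj n x) (hPs hx)
    rw [hPx] at this ⊢
    exact (ContinuousLinearMap.apply ℝ ℝ (tangProj n q)).hasFDerivAt.comp_hasFDerivWithinAt x this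
  have key := HasFDerivWithinAt.comp_proj_eq (P := tangProj n) (B := univ)
    (g := fun _ => (0 : ℝ)) (g' := 0) (uniqueDiffOn_cube hR x hx) hx hPs
    (mapsTo_univ _ _) hd (hasFDerivWithinAt_const _ _ _)
    fun y hy => h.apply_tangProj_eq_zero hR hPs hu0 (tangProj_mem_cube hR.le hy)
      (tangProj_last y) q
  simpa using congrArg (fun T : (𝔼 n) →L[ℝ] ℝ => T p) key

/-- If two functions have the same gradient along the flat boundary, their second derivatives agree
in all tangential directions. -/
theorem HasC2Holder.apply_tangProj_congr (hR : 0 < R)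
    (hu : HasC2Holder α (upperCube n R) u u₁ u₂ C) (hv : HasC2Holder α (lowerCube n R) v v₁ v₂ C')
    (h₁ : ∀ y ∈ cube n R, y (Fin.last n) = 0 → v₁ y = u₁ y)
    {x : 𝔼 n} (hx : x ∈ cube n R) (hxn : x (Fin.last n) = 0) (p : 𝔼 n) :
    v₂ x (tangProj n p) = u₂ x (tangProj n p) := by
  have hPx := tangProj_eq_self hxn
  have key := HasFDerivWithinAt.comp_proj_eq (P := tangProj n) (f := v₁) (g := u₁)
    (f' := v₂ x) (g' := u₂ x) (uniqueDiffOn_cube hR x hx) hx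
    (fun y hy => tangProj_mem_lowerCube hR.le hy) (fun y hy => tangProj_mem_upperCube hR.le hy)
    (by
      have := hv.snd.hasFDeriv x ⟨hx, hxn.le⟩
      rwa [hPx])
    (by
      have := hu.snd.hasFDeriv x ⟨hx, hxn.ge⟩
      rwa [hPx])
    fun y hy => h₁ _ (tangProj_mem_cube hR.le hy) (tangProj_last y)
  simpa using congrArg (fun T : (𝔼 n) →L[ℝ] (𝔼 n) →L[ℝ] ℝ => T p) key

theorem clm_eq_of_tangProj_of_normal {F : Type*} [NormedAddCommGroup F] [NormedSpace ℝ F]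
    {S T : (𝔼 n) →L[ℝ] F} (ht : ∀ p, S (tangProj n p) = T (tangProj n p))
    (hn : S (normalVec n) = T (normalVec n)) : S = T := by
  ext1 p
  rw [← tangProj_add_normal p, map_add, map_add, map_smul, map_smul, ht, hn]

theorem hasDerivAt_reflCurve {δ : ℝ} (hδ : 0 < δ) (k b : ℝ) (x V : 𝔼 n) (t : ℝ) :
    HasDerivAt (fun t => x + profile δ t • V + (k * profile δ t + b * profile δ t ^ 2) • normalVec n)
      (profileDeriv δ t • V +
        (k * profileDeriv δ t + b * (2 * profile δ t * profileDeriv δ t)) • normalVec n) t := by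
  have h := hasDerivAt_profile hδ t
  have h2 : HasDerivAt (fun t => profile δ t ^ 2) (2 * profile δ t * profileDeriv δ t) t := by
    simpa using h.fun_pow 2
  exact ((h.smul_const V).const_add x).add
    (((h.const_mul k).add (h2.const_mul b)).smul_const (normalVec n))

theorem hasDerivAt_reflCurve_deriv {δ : ℝ} (hδ : 0 < δ) (k b : ℝ) (V : 𝔼 n) :
    HasDerivAt (fun t => profileDeriv δ t • V +
        (k * profileDeriv δ t + b * (2 * profile δ t * profileDeriv δ t)) • normalVec n)
      ((2 * b) • normalVec n) 0 := by
  have h := hasDerivAt_profile hδ 0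
  have h' := hasDerivAt_profileDeriv hδ
  have := (h'.smul_const V).add (((h'.const_mul k).add
    (((h.const_mul 2).mul h').const_mul b)).smul_const (normalVec n))
  refine this.congr_deriv ?_
  simp [profileDeriv_zero hδ, mul_comm]

end Jets

theorem sub_smul_normalVec_mem_lowerCube {x : 𝔼 n} (hx : x ∈ cube n R)
    (hxn : x (Fin.last n) = 0) {t : ℝ} (ht : t ∈ Icc 0 R) :
    x - t • normalVec n ∈ lowerCube n R := by
  refine ⟨fun i => ?_, by simpa [hxn] using ht.1⟩
  induction i using Fin.lastCases with
  | last => simpa [hxn, abs_of_nonneg ht.1] using ht.2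
  | cast i => simpa using hx i.castSucc

section ReflectedJets

variable {α C C' : ℝ} {u : (𝔼 n) → ℝ} {u₁ v₁ : (𝔼 n) → (𝔼 n) →L[ℝ] ℝ}
  {u₂ v₂ : (𝔼 n) → (𝔼 n) →L[ℝ] (𝔼 n) →L[ℝ] ℝ} {δ : ℝ} {V W : (𝔼 n) → 𝔼 n} {B : (𝔼 n) → ℝ}

/-- The average of a function over two reflected points, with weights `-1/2` and `1/2`. -/
def reflAvg (δ : ℝ) (V W : (𝔼 n) → 𝔼 n) (B : (𝔼 n) → ℝ) (u : (𝔼 n) → ℝ) (x : 𝔼 n) : ℝ :=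
  (-(1 / 2) : ℝ) • u (reflMap δ 3 V B x) + (1 / 2 : ℝ) • u (reflMap δ 1 W (fun _ => 0) x)

/-- The derivatives of `reflAvg` in the normal direction on the flat boundary. -/
theorem HasC2Holder.reflAvg_normal (hR : 0 < R) (hδ : 0 < δ)
    (hu : HasC2Holder α (upperCube n R) u u₁ u₂ C)
    (hv : HasC2Holder α (lowerCube n R) (reflAvg δ V W B u) v₁ v₂ C')
    (hφ : MapsTo (reflMap δ 3 V B) (lowerCube n R) (upperCube n R))
    (hψ : MapsTo (reflMap δ 1 W (fun _ => 0)) (lowerCube n R) (upperCube n R))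
    {x : 𝔼 n} (hx : x ∈ cube n R) (hxn : x (Fin.last n) = 0) :
    v₁ x (-normalVec n) = (-(1 / 2) : ℝ) * u₁ x (V x + (3 : ℝ) • normalVec n) +
        (1 / 2 : ℝ) * u₁ x (W x + (1 : ℝ) • normalVec n) ∧
      v₂ x (-normalVec n) (-normalVec n) =
        (-(1 / 2) : ℝ) * (u₂ x (V x + (3 : ℝ) • normalVec n) (V x + (3 : ℝ) • normalVec n) +
          u₁ x ((2 * B x) • normalVec n)) +
        (1 / 2 : ℝ) * u₂ x (W x + (1 : ℝ) • normalVec n) (W x + (1 : ℝ) • normalVec n) := by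
  have h0 : (0 : ℝ) ∈ Icc 0 R := ⟨le_rfl, hR.le⟩
  have hI : UniqueDiffOn ℝ (Icc 0 R) := uniqueDiffOn_Icc hR
  set d : ℝ → 𝔼 n := fun t => x - t • normalVec n
  have hdm : MapsTo d (Icc 0 R) (lowerCube n R) := fun t ht =>
    sub_smul_normalVec_mem_lowerCube hx hxn ht
  have hd : ∀ t ∈ Icc 0 R, HasDerivWithinAt d (-normalVec n) (Icc 0 R) t := fun t _ => by
    simpa using (((hasDerivAt_id t).smul_const (normalVec n)).const_sub x).hasDerivWithinAt
  set c : ℝ → (𝔼 n) → ℝ → ℝ → 𝔼 n := fun k V b t =>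
    x + profile δ t • V + (k * profile δ t + b * profile δ t ^ 2) • normalVec n
  set c' : ℝ → (𝔼 n) → ℝ → ℝ → 𝔼 n := fun k V b t => profileDeriv δ t • V +
    (k * profileDeriv δ t + b * (2 * profile δ t * profileDeriv δ t)) • normalVec n
  have hc : ∀ k V b, ∀ t ∈ Icc 0 R, HasDerivWithinAt (c k V b) (c' k V b t) (Icc 0 R) t :=
    fun k V b t _ => (hasDerivAt_reflCurve hδ k b x V t).hasDerivWithinAt
  have hc' : ∀ k V b, HasDerivWithinAt (c' k V b) ((2 * b) • normalVec n) (Icc 0 R) 0 :=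
    fun k V b => (hasDerivAt_reflCurve_deriv hδ k b V).hasDerivWithinAt
  have hc0 : ∀ k V b, c k V b 0 = x := fun k V b => by simp [c]
  have hc'0 : ∀ k V b, c' k V b 0 = V + k • normalVec n := fun k V b => by
    simp [c', profileDeriv_zero hδ]
  have hd0 : d 0 = x := by simp [d]
  have hcV : MapsTo (c 3 (V x) (B x)) (Icc 0 R) (upperCube n R) := fun t ht => by
    have := hφ (hdm ht)
    rwa [reflMap_sub_smul_normal hxn] at this
  have hcW : MapsTo (c 1 (W x) 0) (Icc 0 R) (upperCube n R) := fun t ht => by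
    have := hψ (hdm ht)
    rwa [reflMap_sub_smul_normal hxn] at this
  have hveq : ∀ t, reflAvg δ V W B u (d t) =
      (-(1 / 2) : ℝ) * u (c 3 (V x) (B x) t) + (1 / 2 : ℝ) * u (c 1 (W x) 0 t) := fun t => by
    simp only [reflAvg, d, c, reflMap_sub_smul_normal hxn, smul_eq_mul]
  have hfst : ∀ t ∈ Icc 0 R, v₁ (d t) (-normalVec n) =
      (-(1 / 2) : ℝ) * u₁ (c 3 (V x) (B x) t) (c' 3 (V x) (B x) t) +
        (1 / 2 : ℝ) * u₁ (c 1 (W x) 0 t) (c' 1 (W x) 0 t) := fun t ht => by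
    have e1 := hv.hasDerivWithinAt_curve hd hdm ht
    have e2 := ((hu.hasDerivWithinAt_curve (hc 3 (V x) (B x)) hcV ht).const_mul (-(1 / 2) : ℝ)).add
      ((hu.hasDerivWithinAt_curve (hc 1 (W x) 0) hcW ht).const_mul (1 / 2 : ℝ))
    exact (hI t ht).eq_deriv _ e1 (e2.congr (fun r _ => hveq r) (hveq t))
  refine ⟨by simpa only [hd0, hc0, hc'0] using hfst 0 h0, ?_⟩
  have e1 := hv.hasDerivWithinAt_curve_deriv hd hdm h0 (hasDerivWithinAt_const _ _ _)
  have e2 := ((hu.hasDerivWithinAt_curve_deriv (hc 3 (V x) (B x)) hcV h0 (hc' _ _ _)).const_mul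
    (-(1 / 2) : ℝ)).add
      ((hu.hasDerivWithinAt_curve_deriv (hc 1 (W x) 0) hcW h0 (hc' _ _ _)).const_mul (1 / 2 : ℝ))
  have := (hI 0 h0).eq_deriv _ e1 (e2.congr hfst (hfst 0 h0))
  simpa only [hd0, hc0, hc'0, map_zero, add_zero, mul_zero, zero_smul] using this

/-- The reflected average has the same gradient as `u` on the flat boundary. -/
theorem HasC2Holder.reflAvg_fst_eq (hR : 0 < R) (hδ : 0 < δ)
    (hu : HasC2Holder α (upperCube n R) u u₁ u₂ C)
    (hv : HasC2Holder α (lowerCube n R) (reflAvg δ V W B u) v₁ v₂ C')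
    (hφ : MapsTo (reflMap δ 3 V B) (lowerCube n R) (upperCube n R))
    (hψ : MapsTo (reflMap δ 1 W (fun _ => 0)) (lowerCube n R) (upperCube n R))
    (hu0 : ∀ y ∈ cube n R, y (Fin.last n) = 0 → u y = 0)
    {x : 𝔼 n} (hx : x ∈ cube n R) (hxn : x (Fin.last n) = 0)
    (hV : V x (Fin.last n) = 0) (hW : W x (Fin.last n) = 0) : v₁ x = u₁ x := by
  have hut := hu.apply_tangProj_eq_zero hR (fun y hy => tangProj_mem_upperCube hR.le hy) hu0 hx hxn
  have hvt := hv.apply_tangProj_eq_zero hR (fun y hy => tangProj_mem_lowerCube hR.le hy)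
    (fun y hy hyn => by
      simp only [reflAvg, reflMap_eq_self hyn, hu0 y hy hyn, smul_zero, add_zero]) hx hxn
  have hVx := hut (V x)
  have hWx := hut (W x)
  rw [tangProj_eq_self hV] at hVx
  rw [tangProj_eq_self hW] at hWx
  refine clm_eq_of_tangProj_of_normal (fun p => by rw [hut, hvt]) ?_
  have := (hu.reflAvg_normal hR hδ hv hφ hψ hx hxn).1
  simp only [map_neg, map_add, map_smul, hVx, hWx, smul_eq_mul] at this
  linarith

/-- The reflected average has the same second derivative as `u` on the flat boundary, provided the
perturbation of the reflection is adapted to the boundary relation satisfied by `u`. -/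
theorem HasC2Holder.reflAvg_snd_eq (hR : 0 < R) (hδ : 0 < δ)
    (hu : HasC2Holder α (upperCube n R) u u₁ u₂ C)
    (hv : HasC2Holder α (lowerCube n R) (reflAvg δ V W B u) v₁ v₂ C')
    (hφ : MapsTo (reflMap δ 3 V B) (lowerCube n R) (upperCube n R))
    (hψ : MapsTo (reflMap δ 1 W (fun _ => 0)) (lowerCube n R) (upperCube n R))
    (hu0 : ∀ y ∈ cube n R, y (Fin.last n) = 0 → u y = 0)
    (hV : ∀ y : 𝔼 n, y (Fin.last n) = 0 → V y (Fin.last n) = 0)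
    (hW : ∀ y : 𝔼 n, y (Fin.last n) = 0 → W y (Fin.last n) = 0)
    {x : 𝔼 n} (hx : x ∈ cube n R) (hxn : x (Fin.last n) = 0)
    (hrel : 5 * u₂ x (normalVec n) (normalVec n) =
      u₂ x (normalVec n) (W x - (3 : ℝ) • V x) - B x * u₁ x (normalVec n)) : v₂ x = u₂ x := by
  have hxu : x ∈ upperCube n R := ⟨hx, hxn.ge⟩
  have hxl : x ∈ lowerCube n R := ⟨hx, hxn.le⟩
  have hus := hu.symm (convex_upperCube hR) (interior_upperCube_nonempty hR) hxu
  have hvs := hv.symm (convex_lowerCube hR) (interior_lowerCube_nonempty hR) hxl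
  have htang := hu.apply_tangProj_congr hR hv
    (fun y hy hyn => hu.reflAvg_fst_eq hR hδ hv hφ hψ hu0 hy hyn (hV y hyn) (hW y hyn)) hx hxn
  have hzero := hu.apply_tangProj_tangProj_eq_zero hR
    (fun y hy => tangProj_mem_upperCube hR.le hy) hu0 hx hxn
  have hVV := hzero (V x) (V x)
  have hWW := hzero (W x) (W x)
  rw [tangProj_eq_self (hV x hxn)] at hVV
  rw [tangProj_eq_self (hW x hxn)] at hWW
  have hnn : v₂ x (normalVec n) (normalVec n) = u₂ x (normalVec n) (normalVec n) := by
    have := (hu.reflAvg_normal hR hδ hv hφ hψ hx hxn).2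
    simp only [map_neg, map_add, map_smul, map_sub, neg_apply, add_apply, smul_apply, hVV, hWW,
      smul_eq_mul, hus (V x) (normalVec n), hus (W x) (normalVec n)] at this hrel
    linarith
  refine clm_eq_of_tangProj_of_normal htang (clm_eq_of_tangProj_of_normal (fun p => ?_) hnn)
  rw [hvs, htang, hus]

end ReflectedJets

section BoundaryRelation

variable {α C : ℝ} {u : (𝔼 n) → ℝ} {u₁ : (𝔼 n) → (𝔼 n) →L[ℝ] ℝ}
  {u₂ : (𝔼 n) → (𝔼 n) →L[ℝ] (𝔼 n) →L[ℝ] ℝ}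

theorem HasC2Holder.pdW_eq {s : Set (𝔼 n)} (hs : UniqueDiffOn ℝ s)
    (hu : HasC2Holder α s u u₁ u₂ C) {x : 𝔼 n} (hx : x ∈ s) (i : Fin (n + 1)) :
    pdW s i u x = u₁ x (EuclideanSpace.single i 1) := by
  rw [pdW, (hu.fst.hasFDeriv x hx).fderivWithin (hs x hx)]

theorem HasC2Holder.pdW_pdW_eq {s : Set (𝔼 n)} (hs : UniqueDiffOn ℝ s)
    (hu : HasC2Holder α s u u₁ u₂ C) {x : 𝔼 n} (hx : x ∈ s) (i j : Fin (n + 1)) :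
    pdW s i (pdW s j u) x = u₂ x (EuclideanSpace.single i 1) (EuclideanSpace.single j 1) := by
  have h : HasFDerivWithinAt (pdW s j u)
      ((ContinuousLinearMap.apply ℝ ℝ (EuclideanSpace.single j (1 : ℝ))).comp (u₂ x)) s x :=
    ((ContinuousLinearMap.apply ℝ ℝ
      (EuclideanSpace.single j (1 : ℝ))).hasFDerivAt.comp_hasFDerivWithinAt x
        (hu.snd.hasFDeriv x hx)).congr (fun y hy => hu.pdW_eq hs hy j) (hu.pdW_eq hs hx j)
  rw [pdW, h.fderivWithin (hs x hx)]
  rfl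

/-- On the flat boundary the equation `Lu = 0` reduces to a relation between the normal
derivatives of `u`. -/
theorem HasC2Holder.boundary_relation (hR : 0 < R) (hu : HasC2Holder α (upperCube n R) u u₁ u₂ C)
    (hu0 : ∀ y ∈ cube n R, y (Fin.last n) = 0 → u y = 0)
    {a : Fin (n + 1) → Fin (n + 1) → (𝔼 n) → ℝ} {b : Fin (n + 1) → (𝔼 n) → ℝ} {c : (𝔼 n) → ℝ}
    {x : 𝔼 n} (hx : x ∈ cube n R) (hxn : x (Fin.last n) = 0)
    (hcross : ∀ i, i ≠ Fin.last n → a i (Fin.last n) x = 0)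
    (hL : LopW (upperCube n R) a b c u x = 0) :
    (∑ i : Fin n, a (Fin.last n) i.castSucc x *
        u₂ x (normalVec n) (EuclideanSpace.single i.castSucc 1)) +
      a (Fin.last n) (Fin.last n) x * u₂ x (normalVec n) (normalVec n) +
      b (Fin.last n) x * u₁ x (normalVec n) = 0 := by
  have hxu : x ∈ upperCube n R := ⟨hx, hxn.ge⟩
  have hP : ∀ i : Fin n, tangProj n (EuclideanSpace.single i.castSucc 1) =
      EuclideanSpace.single i.castSucc (1 : ℝ) := fun i =>
    tangProj_eq_self (by simp [(Fin.castSucc_ne_last i).symm])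
  have hPu : MapsTo (tangProj n) (cube n R) (upperCube n R) := fun y hy =>
    tangProj_mem_upperCube hR.le hy
  have h1 : ∀ i : Fin n, u₁ x (EuclideanSpace.single i.castSucc 1) = 0 := fun i => by
    rw [← hP, hu.apply_tangProj_eq_zero hR hPu hu0 hx hxn]
  have h2 : ∀ i j : Fin n, u₂ x (EuclideanSpace.single i.castSucc 1)
      (EuclideanSpace.single j.castSucc 1) = 0 := fun i j => by
    simpa only [hP] using hu.apply_tangProj_tangProj_eq_zero hR hPu hu0 hx hxn
      (EuclideanSpace.single i.castSucc 1) (EuclideanSpace.single j.castSucc 1)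
  have h3 : ∀ i : Fin n, a i.castSucc (Fin.last n) x = 0 := fun i =>
    hcross _ (Fin.castSucc_ne_last i)
  simp only [LopW, hu.pdW_pdW_eq (uniqueDiffOn_upperCube hR) hxu,
    hu.pdW_eq (uniqueDiffOn_upperCube hR) hxu, Fin.sum_univ_castSucc, h1, h2, h3, hu0 x hx hxn,
    mul_zero, zero_mul, Finset.sum_const_zero, add_zero, zero_add] at hL
  exact hL

end BoundaryRelation

section Reflections

/-- The tangential vector field with coefficients `γ i`. -/
def tangField (γ : Fin n → (𝔼 n) → ℝ) (y : 𝔼 n) : 𝔼 n :=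
  ∑ i : Fin n, γ i y • EuclideanSpace.single i.castSucc (1 : ℝ)

@[simp] theorem tangField_last (γ : Fin n → (𝔼 n) → ℝ) (y : 𝔼 n) :
    tangField γ y (Fin.last n) = 0 := by
  simp [tangField, (Fin.castSucc_ne_last _).symm]

@[simp] theorem tangField_castSucc (γ : Fin n → (𝔼 n) → ℝ) (y : 𝔼 n) (i : Fin n) :
    tangField γ y i.castSucc = γ i y := by
  simp [tangField, Pi.single_apply]

theorem reflMap_last (δ k : ℝ) {V : (𝔼 n) → 𝔼 n} (B : (𝔼 n) → ℝ) {x : 𝔼 n}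
    (hV : V (tangProj n x) (Fin.last n) = 0) : reflMap δ k V B x (Fin.last n) =
      k * profile δ (-x (Fin.last n)) + B (tangProj n x) * profile δ (-x (Fin.last n)) ^ 2 := by
  simp [reflMap, hV]

theorem reflMap_castSucc (δ k : ℝ) (V : (𝔼 n) → 𝔼 n) (B : (𝔼 n) → ℝ) (x : 𝔼 n) (i : Fin n) :
    reflMap δ k V B x i.castSucc =
      x i.castSucc + profile δ (-x (Fin.last n)) * V (tangProj n x) i.castSucc := by
  simp [reflMap]

theorem mapsTo_reflMap {δ k M N Γ : ℝ} (hδ : 0 < δ) (hk : 0 ≤ k) (hM : 0 ≤ M)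
    (hMδ : M * δ ≤ 1) (hN : N ≤ M * R) (hΓ : Γ * δ ≤ k) (hkR : 2 * k * δ ≤ R)
    {G : (𝔼 n) → 𝔼 n} {B : (𝔼 n) → ℝ}
    (hG : ∀ y ∈ cube n R, y (Fin.last n) = 0 →
      G y (Fin.last n) = 0 ∧ ∀ i : Fin n, |G y i.castSucc| ≤ N)
    (hB : ∀ y ∈ cube n R, y (Fin.last n) = 0 → |B y| ≤ Γ) (hR : 0 < R) :
    MapsTo (reflMap δ k (fun y => (-M) • y + G y) B) (lowerCube n R) (upperCube n R) := by
  intro x hx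
  have hP := tangProj_mem_cube hR.le hx.1
  have hPn := tangProj_last x
  have hl := reflMap_last δ k B (V := fun y => (-M) • y + G y) (x := x)
    (by simp [(hG _ hP hPn).1])
  have hi := reflMap_castSucc δ k (fun y => (-M) • y + G y) B x
  have hBx := hB _ hP hPn
  have hGx := (hG _ hP hPn).2
  set θ := profile δ (-x (Fin.last n))
  have hθ0 : 0 ≤ θ := profile_nonneg (by linarith [hx.2])
  have hθδ : θ ≤ δ := profile_le hδ
  have hBθ : |B (tangProj n x) * θ| ≤ k := by
    rw [abs_mul, abs_of_nonneg hθ0]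
    have := abs_nonneg (B (tangProj n x))
    nlinarith
  have hln : 0 ≤ reflMap δ k (fun y => (-M) • y + G y) B x (Fin.last n) := by
    rw [hl]
    nlinarith [(abs_le.1 hBθ).1]
  refine ⟨fun i => ?_, hln⟩
  induction i using Fin.lastCases with
  | last =>
    rw [abs_of_nonneg hln, hl]
    nlinarith [(abs_le.1 hBθ).2]
  | cast i =>
    rw [hi]
    simp only [PiLp.add_apply, PiLp.smul_apply, tangProj_castSucc, smul_eq_mul]
    have h1 := abs_le.1 (hx.1 i.castSucc)
    have h2 := abs_le.1 (hGx i)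
    have h3 : 0 ≤ 1 - M * θ := by nlinarith
    rw [abs_le]
    constructor
    · nlinarith [mul_le_mul_of_nonneg_left h2.1 hθ0, mul_le_mul_of_nonneg_left h1.1 h3,
        mul_le_mul_of_nonneg_left hN hθ0]
    · nlinarith [mul_le_mul_of_nonneg_left h2.2 hθ0, mul_le_mul_of_nonneg_left h1.2 h3,
        mul_le_mul_of_nonneg_left hN hθ0]

/-- Existence of a pair of perturbed reflections adapted to given coefficients on the flat
boundary. -/
theorem exists_reflections {α : ℝ} (hα : 0 ≤ α) (hα1 : α ≤ 1) (hR : 0 < R) {Γ : ℝ} (hΓ : 0 ≤ Γ)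
    {γ : Fin n → (𝔼 n) → ℝ} {β : (𝔼 n) → ℝ}
    (hγ : ∀ i, IsC2Holder α (upperCube n R) (γ i)) (hβ : IsC2Holder α (upperCube n R) β)
    (hγΓ : ∀ i, ∀ x ∈ upperCube n R, |γ i x| ≤ Γ) (hβΓ : ∀ x ∈ upperCube n R, |β x| ≤ Γ) :
    ∃ (δ : ℝ) (V W : (𝔼 n) → 𝔼 n) (B : (𝔼 n) → ℝ), 0 < δ ∧
      IsC2Holder α (lowerCube n R) (reflMap δ 3 V B) ∧
      IsC2Holder α (lowerCube n R) (reflMap δ 1 W fun _ => 0) ∧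
      MapsTo (reflMap δ 3 V B) (lowerCube n R) (upperCube n R) ∧
      MapsTo (reflMap δ 1 W fun _ => 0) (lowerCube n R) (upperCube n R) ∧
      (∀ y : 𝔼 n, y (Fin.last n) = 0 → V y (Fin.last n) = 0) ∧
      (∀ y : 𝔼 n, y (Fin.last n) = 0 → W y (Fin.last n) = 0) ∧
      (∀ y, W y - (3 : ℝ) • V y = (-5 : ℝ) • tangField γ y) ∧ ∀ y, B y = 5 * β y := by
  have smooth {F : Type} [NormedAddCommGroup F] [NormedSpace ℝ F] {f : (𝔼 n) → F}
      (hf : ContDiff ℝ 3 f) : IsC2Holder α (upperCube n R) f :=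
    IsC2Holder.of_contDiffOn hα hα1 (isCompact_upperCube hR) (convex_upperCube hR)
      (uniqueDiffOn_upperCube hR) hf.contDiffOn
  set M := 2 * Γ / R
  have hM : 0 ≤ M := by positivity
  have hMR : M * R = 2 * Γ := by simp only [M]; field_simp
  set δ := R / (6 * (1 + Γ) * (1 + R))
  have hδ : 0 < δ := by positivity
  have hδR : δ * (6 * (1 + Γ) * (1 + R)) = R := by simp only [δ]; field_simp
  have hΓδ : 6 * (Γ * δ) ≤ R ∧ 6 * (Γ * δ) ≤ 1 ∧ 6 * δ ≤ R := by
    have h1 : 0 ≤ Γ * δ := by positivity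
    have h2 : 0 ≤ δ * R := by positivity
    have h3 : 0 ≤ Γ * δ * R := by positivity
    refine ⟨by nlinarith, ?_, by nlinarith⟩
    refine le_of_mul_le_mul_right (a := R) ?_ hR
    nlinarith
  obtain ⟨h6R, h61, hδ6⟩ := hΓδ
  have h3M : 3 * M * δ ≤ 1 := by
    refine le_of_mul_le_mul_right (a := R) ?_ hR
    calc 3 * M * δ * R = 3 * (M * R) * δ := by ring
      _ = 6 * (Γ * δ) := by rw [hMR]; ring
      _ ≤ 1 * R := by linarith
  have hMδ : 0 ≤ M * δ := by positivity
  have hup : ∀ y ∈ cube n R, y (Fin.last n) = 0 → y ∈ upperCube n R := fun y hy h => ⟨hy, h.ge⟩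
  have hfield : IsC2Holder α (upperCube n R) (tangField γ) :=
    IsC2Holder.sum _ fun i => (hγ i).smul (smooth contDiff_const)
  refine ⟨δ, fun y => (-M) • y + 0, fun y => (-(3 * M)) • y + (-5 : ℝ) • tangField γ y,
    fun y => 5 * β y, hδ, ?_, ?_, ?_, ?_, ?_, ?_, ?_, fun _ => rfl⟩
  · exact isC2Holder_reflMap hα hα1 hR hδ 3
      (smooth ((contDiff_id.const_smul (-M)).add contDiff_const))
      ((smooth (contDiff_const (c := (5 : ℝ)))).smul hβ)
  · exact isC2Holder_reflMap hα hα1 hR hδ 1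
      ((smooth (contDiff_id.const_smul (-(3 * M)))).add
        ((smooth (contDiff_const (c := (-5 : ℝ)))).smul hfield)) (smooth contDiff_const)
  · refine mapsTo_reflMap (N := 0) (Γ := 5 * Γ) hδ (by norm_num) hM (by linarith) (by positivity)
      (by linarith) (by linarith) (fun y _ _ => by simp) (fun y hy hyn => ?_) hR
    rw [abs_mul, abs_of_pos (by norm_num : (0 : ℝ) < 5)]
    linarith [hβΓ y (hup y hy hyn)]
  · refine mapsTo_reflMap (N := 5 * Γ) (Γ := 0) hδ (by norm_num) (by positivity) h3M
      (by linarith) (by linarith) (by linarith) (fun y hy hyn => ⟨by simp, fun i => ?_⟩)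
      (fun y _ _ => by simp) hR
    simp only [PiLp.smul_apply, tangField_castSucc, smul_eq_mul, abs_mul, abs_neg]
    rw [abs_of_pos (by norm_num : (0 : ℝ) < 5)]
    linarith [hγΓ i y (hup y hy hyn)]
  · intro y hy
    simp [hy]
  · intro y hy
    simp [hy]
  · intro y
    dsimp only
    module

end Reflections

section Extension

theorem IsC2Holder.inv {E : Type*} [NormedAddCommGroup E] [NormedSpace ℝ E] {α : ℝ} (hα : 0 ≤ α)
    (hα1 : α ≤ 1) {s : Set E} (hs : Convex ℝ s) {f : E → ℝ} (hf : IsC2Holder α s f) {l r : ℝ}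
    (hl : 0 < l) (hlr : l < r) (hfs : MapsTo f s (Icc l r)) :
    IsC2Holder α s (fun x => (f x)⁻¹) := by
  have hinv : IsC2Holder α (Icc l r) (fun t : ℝ => t⁻¹) :=
    IsC2Holder.of_contDiffOn hα hα1 isCompact_Icc (convex_Icc _ _) (uniqueDiffOn_Icc hlr)
      fun t ht => (contDiffAt_inv ℝ (hl.trans_le ht.1).ne').contDiffWithinAt
  exact hinv.comp hα hs hf hfs

theorem MemC2α.isC2Holder {α : ℝ≥0} (hα1 : α ≤ 1) {s : Set (𝔼 n)} (hc : IsCompact s)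
    (hs : Convex ℝ s) (hu : UniqueDiffOn ℝ s) {f : (𝔼 n) → ℝ} (hf : MemC2α α f s) :
    IsC2Holder α s f := by
  obtain ⟨M, hM⟩ := exists_c2HolderBound hc hu hf.1 hf.2
  obtain ⟨D, hD1, hD⟩ := exists_diam_bound hc
  exact ⟨_, _, D * M, by positivity, HasC2Holder.of_c2HolderBound hα1 hs hu hD1 hD hf.1 hM⟩

variable {δ : ℝ} {V W : (𝔼 n) → 𝔼 n} {B : (𝔼 n) → ℝ}

open scoped Classical in
/-- Extension from the upper half of the cube by the reflected average. -/
def reflExtension (R δ : ℝ) (V W : (𝔼 n) → 𝔼 n) (B : (𝔼 n) → ℝ) (u : (𝔼 n) → ℝ) : (𝔼 n) → ℝ :=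
  (upperCube n R).piecewise u (reflAvg δ V W B u)

theorem eqOn_reflExtension (u : (𝔼 n) → ℝ) :
    EqOn (reflExtension R δ V W B u) u (upperCube n R) := by
  classical exact piecewise_eqOn _ _ _

theorem reflExtension_of_notMem (u : (𝔼 n) → ℝ) {x : 𝔼 n} (hx : x ∉ upperCube n R) :
    reflExtension R δ V W B u x = reflAvg δ V W B u x := by
  classical exact piecewise_eq_of_notMem _ _ _ hx

theorem reflExtension_add (u v : (𝔼 n) → ℝ) (x : 𝔼 n) :
    reflExtension R δ V W B (u + v) x =
      reflExtension R δ V W B u x + reflExtension R δ V W B v x := by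
  by_cases hx : x ∈ upperCube n R
  · simp only [eqOn_reflExtension _ hx, Pi.add_apply]
  · simp only [reflExtension_of_notMem _ hx, reflAvg, Pi.add_apply, smul_eq_mul]
    ring

theorem reflExtension_smul (r : ℝ) (u : (𝔼 n) → ℝ) (x : 𝔼 n) :
    reflExtension R δ V W B (r • u) x = r * reflExtension R δ V W B u x := by
  by_cases hx : x ∈ upperCube n R
  · simp only [eqOn_reflExtension _ hx, Pi.smul_apply, smul_eq_mul]
  · simp only [reflExtension_of_notMem _ hx, reflAvg, Pi.smul_apply, smul_eq_mul]
    ring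

theorem supNormOn_reflExtension (hR : 0 < R)
    (hφ : MapsTo (reflMap δ 3 V B) (lowerCube n R) (upperCube n R))
    (hψ : MapsTo (reflMap δ 1 W (fun _ => 0)) (lowerCube n R) (upperCube n R))
    {u : (𝔼 n) → ℝ} (hu : ContinuousOn u (upperCube n R)) :
    supNormOn (reflExtension R δ V W B u) (cube n R) = supNormOn u (upperCube n R) := by
  have hbdd : BddAbove ((fun x => |u x|) '' upperCube n R) :=
    (isCompact_upperCube hR).bddAbove_image hu.abs
  have hle : ∀ x ∈ upperCube n R, |u x| ≤ supNormOn u (upperCube n R) := fun x hx =>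
    le_csSup hbdd ⟨x, hx, rfl⟩
  have hne : (upperCube n R).Nonempty := (interior_upperCube_nonempty hR).mono interior_subset
  have hub : ∀ x ∈ cube n R,
      |reflExtension R δ V W B u x| ≤ supNormOn u (upperCube n R) := fun x hx => by
    by_cases hxu : x ∈ upperCube n R
    · rw [eqOn_reflExtension _ hxu]
      exact hle x hxu
    · have hxl : x ∈ lowerCube n R := by
        rw [cube_eq_union] at hx
        exact hx.resolve_left hxu
      have h1 := abs_le.1 (hle _ (hφ hxl))
      have h2 := abs_le.1 (hle _ (hψ hxl))
      rw [reflExtension_of_notMem _ hxu, reflAvg, abs_le, smul_eq_mul, smul_eq_mul]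
      constructor <;> linarith [h1.1, h1.2, h2.1, h2.2]
  have hsub : upperCube n R ⊆ cube n R := fun x hx => hx.1
  refine le_antisymm (csSup_le ((hne.mono hsub).image _) ?_) (csSup_le (hne.image _) ?_)
  · rintro _ ⟨x, hx, rfl⟩
    exact hub x hx
  · rintro _ ⟨x, hx, rfl⟩
    refine le_csSup ⟨supNormOn u (upperCube n R), ?_⟩ ⟨x, hsub hx, ?_⟩
    · rintro _ ⟨y, hy, rfl⟩
      exact hub y hy
    · simp only [eqOn_reflExtension _ hx]

theorem HasC2Holder.reflExtension {α C : ℝ} (hα : 0 ≤ α) (hR : 0 < R) (hC : 0 ≤ C)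
    {u : (𝔼 n) → ℝ} {u₁ v₁ : (𝔼 n) → (𝔼 n) →L[ℝ] ℝ} {u₂ v₂ : (𝔼 n) → (𝔼 n) →L[ℝ] (𝔼 n) →L[ℝ] ℝ}
    (hu : HasC2Holder α (upperCube n R) u u₁ u₂ C)
    (hv : HasC2Holder α (lowerCube n R) (reflAvg δ V W B u) v₁ v₂ C)
    (hu0 : ∀ y ∈ cube n R, y (Fin.last n) = 0 → u y = 0)
    (h₁ : ∀ y ∈ cube n R, y (Fin.last n) = 0 → v₁ y = u₁ y)
    (h₂ : ∀ y ∈ cube n R, y (Fin.last n) = 0 → v₂ y = u₂ y) :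
    ∃ w₁ w₂, HasC2Holder α (cube n R) (reflExtension R δ V W B u) w₁ w₂ (2 * C) := by
  classical
  have hflat : ∀ y ∈ upperCube n R ∩ lowerCube n R, y (Fin.last n) = 0 := fun y hy =>
    le_antisymm hy.2.2 hy.1.2
  have hcu := (isCompact_upperCube (n := n) hR).isClosed
  have hcl := (isCompact_lowerCube (n := n) hR).isClosed
  have hcross : ∀ x ∈ upperCube n R, ∀ y ∈ lowerCube n R, ∃ z ∈ upperCube n R ∩ lowerCube n R,
      ‖x - z‖ ≤ ‖x - y‖ ∧ ‖z - y‖ ≤ ‖x - y‖ := fun x hx y hy => exists_mem_interface hx hy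
  have e0 : EqOn u (reflAvg δ V W B u) (upperCube n R ∩ lowerCube n R) := fun y hy => by
    simp only [reflAvg, reflMap_eq_self (hflat y hy), hu0 y hy.1.1 (hflat y hy), smul_zero,
      add_zero]
  have e1 : EqOn u₁ v₁ (upperCube n R ∩ lowerCube n R) := fun y hy =>
    (h₁ y hy.1.1 (hflat y hy)).symm
  have e2 : EqOn u₂ v₂ (upperCube n R ∩ lowerCube n R) := fun y hy =>
    (h₂ y hy.1.1 (hflat y hy)).symm
  rw [cube_eq_union]
  refine ⟨_, _, ?_, hu.snd.glue hcross hcu hcl hα hC hv.snd e1 e2⟩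
  unfold _root_.reflExtension
  convert hu.fst.glue hcross hcu hcl hα hC hv.fst e0 e1

end Extension

end Cube

/-- Theorem 3.8, extension operator on a straight boundary. Let
`Q = [−R, R]^{n+1}`, `Q^{0,+}` its upper half. If `L` is uniformly elliptic with
`a_{ij}, b_i ∈ C^{2,α}(Q^{0,+})` and no mixed normal terms on the flat boundary, then
there is a continuous linear extension operator `E : X₁ → C^{2,α}(Q)`, where
`X₁ = {u ∈ C^{2,α}(Q^{0,+}) ∣ u = Lu = 0 on {x_n = 0}}`, with `Eu = u` on `Q^{0,+}` and
`‖Eu‖_{C⁰(Q)} = ‖u‖_{C⁰(Q^{0,+})}`. -/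
theorem extension_operator_straight_boundary
    {n : ℕ} (R : ℝ) (hR : 0 < R)
    (α : ℝ≥0) (hα0 : 0 < α) (hα1 : α ≤ 1)
    (a : Fin (n + 1) → Fin (n + 1) → EuclideanSpace ℝ (Fin (n + 1)) → ℝ)
    (b : Fin (n + 1) → EuclideanSpace ℝ (Fin (n + 1)) → ℝ)
    (c : EuclideanSpace ℝ (Fin (n + 1)) → ℝ)
    (Q : Set (EuclideanSpace ℝ (Fin (n + 1)))) (hQ : Q = {x | ∀ i, |x i| ≤ R})
    (Q0p : Set (EuclideanSpace ℝ (Fin (n + 1))))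
    (hQ0p : Q0p = {x ∈ Q | 0 ≤ x (Fin.last n)})
    (ha : ∀ i j, MemC2α α (a i j) Q0p)
    (hb : ∀ i, MemC2α α (b i) Q0p)
    (hc : MemC0α α c Q0p)
    (lam Lam : ℝ) (hlam : 0 < lam)
    (hell : UnifElliptic a lam Q0p)
    (hcoeff : CoeffBound a b c Lam Q0p)
    -- no mixed second-order terms on the flat boundary
    (hnocross : ∀ x ∈ Q0p, x (Fin.last n) = 0 →
      ∀ i : Fin (n + 1), i ≠ Fin.last n → a i (Fin.last n) x = 0) :
    ∃ E : (EuclideanSpace ℝ (Fin (n + 1)) → ℝ) → (EuclideanSpace ℝ (Fin (n + 1)) → ℝ),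
    ∃ K : ℝ≥0,
      -- linearity of `E` on `X₁`
      (∀ u v, (MemC2α α u Q0p ∧ ∀ x ∈ Q0p, x (Fin.last n) = 0 →
          u x = 0 ∧ LopW Q0p a b c u x = 0) →
        (MemC2α α v Q0p ∧ ∀ x ∈ Q0p, x (Fin.last n) = 0 →
          v x = 0 ∧ LopW Q0p a b c v x = 0) →
        ∀ x, E (u + v) x = E u x + E v x) ∧
      (∀ (r : ℝ) u, (MemC2α α u Q0p ∧ ∀ x ∈ Q0p, x (Fin.last n) = 0 →
          u x = 0 ∧ LopW Q0p a b c u x = 0) →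
        ∀ x, E (r • u) x = r * E u x) ∧
      (∀ u, (MemC2α α u Q0p ∧ ∀ x ∈ Q0p, x (Fin.last n) = 0 →
          u x = 0 ∧ LopW Q0p a b c u x = 0) →
        -- `Eu` extends `u` and lies in `C^{2,α}(Q)`
        EqOn (E u) u Q0p ∧
        MemC2α α (E u) Q ∧
        -- the sup-norm is preserved
        supNormOn (E u) Q = supNormOn u Q0p ∧
        -- continuity of `E` w.r.t. the `C^{2,α}`-norms
        (∀ M : ℝ≥0,
          ((∀ i : ℕ, i ≤ 2 → ∀ x ∈ Q0p,
              ‖iteratedFDerivWithin ℝ i u Q0p x‖ ≤ (M : ℝ)) ∧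
            HolderOnWith M α (iteratedFDerivWithin ℝ 2 u Q0p) Q0p) →
          ((∀ i : ℕ, i ≤ 2 → ∀ x ∈ Q,
              ‖iteratedFDerivWithin ℝ i (E u) Q x‖ ≤ (K * M : ℝ≥0)) ∧
            HolderOnWith (K * M) α (iteratedFDerivWithin ℝ 2 (E u) Q) Q))) := by
  obtain rfl : Q = cube n R := hQ
  obtain rfl : Q0p = upperCube n R := hQ0p
  have hα : (0 : ℝ) ≤ α := α.coe_nonneg
  have hα1' : (α : ℝ) ≤ 1 := by exact_mod_cast hα1
  have hcU := isCompact_upperCube (n := n) hR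
  have hsU := convex_upperCube (n := n) hR
  have huU := uniqueDiffOn_upperCube (n := n) hR
  have hsub : ∀ y ∈ cube n R, y (Fin.last n) = 0 → y ∈ upperCube n R := fun y hy h => ⟨hy, h.ge⟩
  set N := Fin.last n
  have hNN : ∀ x ∈ upperCube n R, lam ≤ a N N x ∧ a N N x ≤ Lam := fun x hx => by
    refine ⟨?_, (abs_le.1 ((hcoeff x hx).1 N N)).2⟩
    have := hell x hx (EuclideanSpace.single N 1)
    simpa [Pi.single_apply] using this
  obtain ⟨x₀, hx₀⟩ := (interior_upperCube_nonempty (n := n) hR).mono interior_subset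
  have hlamLam : lam ≤ Lam := (hNN x₀ hx₀).1.trans (hNN x₀ hx₀).2
  have hinv : IsC2Holder α (upperCube n R) fun x => (a N N x)⁻¹ :=
    ((ha N N).isC2Holder hα1 hcU hsU huU).inv hα hα1' hsU hlam (r := Lam + 1) (by linarith)
      fun x hx => ⟨(hNN x hx).1, by linarith [(hNN x hx).2]⟩
  have hquot : ∀ f : EuclideanSpace ℝ (Fin (n + 1)) → ℝ, ∀ x ∈ upperCube n R, |f x| ≤ Lam →
      |f x * (a N N x)⁻¹| ≤ Lam / lam := fun f x hx hf => by
    have h0 := hlam.trans_le (hNN x hx).1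
    rw [abs_mul, abs_of_pos (inv_pos.2 h0), div_eq_mul_inv]
    exact mul_le_mul hf (inv_anti₀ hlam (hNN x hx).1) (inv_pos.2 h0).le (hlam.le.trans hlamLam)
  obtain ⟨δ, V, W, B, hδ, hφ, hψ, hφm, hψm, hV, hW, hWV, hB⟩ := exists_reflections (n := n) hα hα1'
    hR (Γ := Lam / lam) (div_nonneg (hlam.le.trans hlamLam) hlam.le)
    (γ := fun i x => a N i.castSucc x * (a N N x)⁻¹) (β := fun x => b N x * (a N N x)⁻¹)
    (fun i => ((ha N i.castSucc).isC2Holder hα1 hcU hsU huU).smul hinv)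
    (((hb N).isC2Holder hα1 hcU hsU huU).smul hinv)
    (fun i x hx => hquot _ x hx ((hcoeff x hx).1 _ _))
    (fun x hx => hquot _ x hx ((hcoeff x hx).2.1 _))
  obtain ⟨K₁, hK₁, hφK⟩ := hφ.exists_comp_bound (G := ℝ) hα (convex_lowerCube hR) hφm
  obtain ⟨K₂, hK₂, hψK⟩ := hψ.exists_comp_bound (G := ℝ) hα (convex_lowerCube hR) hψm
  obtain ⟨D, hD1, hD⟩ := exists_diam_bound hcU
  have hD0 : 0 ≤ D := by linarith
  set K : ℝ≥0 := ⟨2 * ((1 + K₁ + K₂) * D), by positivity⟩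
  have key : ∀ u, (MemC2α α u (upperCube n R) ∧ ∀ x ∈ upperCube n R, x N = 0 →
      u x = 0 ∧ LopW (upperCube n R) a b c u x = 0) → ∀ M : ℝ≥0,
      C2HolderBound α (upperCube n R) u M → ∃ w₁ w₂,
        HasC2Holder α (cube n R) (reflExtension R δ V W B u) w₁ w₂ ((K * M : ℝ≥0) : ℝ) := by
    intro u hu M hM
    have hu0 : ∀ y ∈ cube n R, y N = 0 → u y = 0 := fun y hy hyn =>
      (hu.2 y (hsub y hy hyn) hyn).1
    have hU := HasC2Holder.of_c2HolderBound hα1 hsU huU hD1 hD hu.1.1 hM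
    have hDM : 0 ≤ D * M := by positivity
    obtain ⟨g₁, g₂, hg⟩ := hφK _ _ _ _ hDM hU
    obtain ⟨h₁, h₂, hh⟩ := hψK _ _ _ _ hDM hU
    have hKC : 0 ≤ K₁ * (D * M) ∧ 0 ≤ K₂ * (D * M) := ⟨by positivity, by positivity⟩
    have hL := ((hg.const_smul (-(1 / 2) : ℝ)).add (hh.const_smul (1 / 2 : ℝ))).mono
      (D := (1 + K₁ + K₂) * (D * M)) (by
        rw [abs_neg, abs_of_pos (by norm_num : (0 : ℝ) < 1 / 2)]
        nlinarith [hKC.1, hKC.2])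
    replace hU := hU.mono (D := (1 + K₁ + K₂) * (D * M)) (by nlinarith [hKC.1, hKC.2])
    obtain ⟨w₁, w₂, hw⟩ := HasC2Holder.reflExtension (V := V) (W := W) (B := B) (δ := δ) hα hR
      (by positivity) hU hL hu0
      (fun y hy hyn => hU.reflAvg_fst_eq hR hδ hL hφm hψm hu0 hy hyn (hV y hyn) (hW y hyn))
      (fun y hy hyn => hU.reflAvg_snd_eq hR hδ hL hφm hψm hu0 hV hW hy hyn (by
        have hy' := hsub y hy hyn
        have hrel := hU.boundary_relation hR hu0 hy hyn (hnocross y hy' hyn) (hu.2 y hy' hyn).2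
        have hne : a N N y ≠ 0 := (hlam.trans_le (hNN y hy').1).ne'
        rw [hWV, hB, tangField]
        simp only [map_smul, map_sum, smul_eq_mul]
        have hsum : ∑ i : Fin n, a N i.castSucc y * (a N N y)⁻¹ *
            fderivWithin ℝ (fderivWithin ℝ u (upperCube n R)) (upperCube n R) y (normalVec n)
              (EuclideanSpace.single i.castSucc 1) = (a N N y)⁻¹ * ∑ i : Fin n, a N i.castSucc y *
            fderivWithin ℝ (fderivWithin ℝ u (upperCube n R)) (upperCube n R) y (normalVec n)
              (EuclideanSpace.single i.castSucc 1) := by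
          rw [Finset.mul_sum]
          exact Finset.sum_congr rfl fun i _ => by ring
        rw [hsum]
        field_simp
        linear_combination hrel))
    refine ⟨w₁, w₂, ?_⟩
    convert hw using 1
    rw [NNReal.coe_mul]
    change 2 * ((1 + K₁ + K₂) * D) * (M : ℝ) = _
    ring
  refine ⟨reflExtension R δ V W B, K, fun u v _ _ x => reflExtension_add u v x,
    fun r u _ x => reflExtension_smul r u x, fun u hu => ⟨eqOn_reflExtension u, ?_,
      supNormOn_reflExtension hR hφm hψm hu.1.1.continuousOn, fun M hM => ?_⟩⟩
  · obtain ⟨M, hM⟩ := exists_c2HolderBound hcU huU hu.1.1 hu.1.2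
    obtain ⟨w₁, w₂, hw⟩ := key u hu M hM
    exact ⟨hw.contDiffOn (by exact_mod_cast hα0) (uniqueDiffOn_cube hR), _,
      (hw.c2HolderBound (uniqueDiffOn_cube hR)).2⟩
  · obtain ⟨w₁, w₂, hw⟩ := key u hu M hM
    exact hw.c2HolderBound (uniqueDiffOn_cube hR)
end
end
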